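/- arXiv:math/0409348 — 2 statements merged into one kernel-verified Lean document; each statement's English description precedes it below -/
import Mathlib

section
/- Let α ∈ ℂ satisfy 7α³ + 7α + 1 = 0 and let S_α := P − U_{a₁,…,a₅} with a₁ := −(12/7)α² − (384/49)α − 8/7, a₂ := −(32/7)α² + (24/49)α − 4, a₃ := −4α² + (24/49)α − 4, a₄ := −(8/7)α² + (8/49)α − 8/7, a₅ := 49α² − 7α + 50. Then the plane septic curve {S_α(x, 0, z, w) = 0} in ℙ²(ℂ) has exactly 15 singular points, every one of them is a node, and exactly one of them satisfies x = 0. -/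
open MvPolynomial

/-- The septic `P(x,y,z,w)` (variables `X 0 = x, X 1 = y, X 2 = z, X 3 = w`). -/
noncomputable def Psept : MvPolynomial (Fin 4) ℂ :=
  X 0 * ((X 0) ^ 6 - 21 * (X 0) ^ 4 * (X 1) ^ 2 + 35 * (X 0) ^ 2 * (X 1) ^ 4
      - 7 * (X 1) ^ 6)
    + 7 * X 2 * (((X 0) ^ 2 + (X 1) ^ 2) ^ 3
        - 8 * (X 2) ^ 2 * ((X 0) ^ 2 + (X 1) ^ 2) ^ 2
        + 16 * (X 2) ^ 4 * ((X 0) ^ 2 + (X 1) ^ 2))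
    - 64 * (X 2) ^ 7

/-- `U_{a₁,…,a₅}(x,y,z,w) = (z + a₅w)(a₁z³ + a₂z²w + a₃zw² + a₄w³ + (z+w)(x²+y²))²`. -/
noncomputable def Usept (a₁ a₂ a₃ a₄ a₅ : ℂ) : MvPolynomial (Fin 4) ℂ :=
  (X 2 + C a₅ * X 3) *
    (C a₁ * (X 2) ^ 3 + C a₂ * (X 2) ^ 2 * X 3 + C a₃ * X 2 * (X 3) ^ 2
        + C a₄ * (X 3) ^ 3 + (X 2 + X 3) * ((X 0) ^ 2 + (X 1) ^ 2)) ^ 2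

/-- All partial derivatives of `G` vanish at `v`. -/
def VanishingJacobianAt (G : MvPolynomial (Fin 3) ℂ) (v : Fin 3 → ℂ) : Prop :=
  ∀ i, eval v (pderiv i G) = 0

/-- The Hessian matrix `(∂²G/∂xᵢ∂xⱼ)(v)`. -/
noncomputable def hessianAt (G : MvPolynomial (Fin 3) ℂ) (v : Fin 3 → ℂ) :
    Matrix (Fin 3) (Fin 3) ℂ :=
  Matrix.of fun i j => eval v (pderiv i (pderiv j G))

/-- A point of ℙ²(ℂ) is a singular point of the plane curve `{G = 0}` if it is
represented by a nonzero vector at which all three partial derivatives of `G`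
vanish. -/
def IsSingularPoint (G : MvPolynomial (Fin 3) ℂ)
    (q : Projectivization ℂ (Fin 3 → ℂ)) : Prop :=
  ∃ v : Fin 3 → ℂ, ∃ hv : v ≠ 0, Projectivization.mk ℂ v hv = q ∧
    VanishingJacobianAt G v

/-- A point of ℙ²(ℂ) is a node of `{G = 0}` if it is represented by a nonzero
vector at which all partial derivatives of `G` vanish and the 3×3 Hessian
matrix has rank 2. -/
def IsNode (G : MvPolynomial (Fin 3) ℂ)
    (q : Projectivization ℂ (Fin 3 → ℂ)) : Prop :=
  ∃ v : Fin 3 → ℂ, ∃ hv : v ≠ 0, Projectivization.mk ℂ v hv = q ∧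
    VanishingJacobianAt G v ∧ (hessianAt G v).rank = 2

/-- A point of ℙ²(ℂ) (coordinates x, z, w) satisfies `x = 0`. -/
def LiesOnAxisX0 (q : Projectivization ℂ (Fin 3 → ℂ)) : Prop :=
  ∃ v : Fin 3 → ℂ, ∃ hv : v ≠ 0, Projectivization.mk ℂ v hv = q ∧ v 0 = 0


namespace Septic

/-- The cubic `R`, in the coordinates `x`, `a = x - z`. -/
def cR {K : Type*} [CommRing K] (x a : K) : K :=
  7 * x ^ 3 - 28 * x ^ 2 * a + 28 * x * a ^ 2 - 8 * a ^ 3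

/-- The cubic `q`, in the coordinates `x`, `a = x - z`, `b = α² (z + a₅ w)`. -/
def cq {K : Type*} [CommRing K] (x a b : K) : K :=
  7 * x ^ 3 - 7 * x ^ 2 * a - 21 * x ^ 2 * b + 56 * x * a * b - 28 * x * b ^ 2
    - 28 * a ^ 2 * b + 28 * a * b ^ 2 - 8 * b ^ 3

def cRx {K : Type*} [CommRing K] (x a : K) : K := 21 * x ^ 2 - 56 * x * a + 28 * a ^ 2
def cRa {K : Type*} [CommRing K] (x a : K) : K := -28 * x ^ 2 + 56 * x * a - 24 * a ^ 2
def cqx {K : Type*} [CommRing K] (x a b : K) : K := 21 * x ^ 2 - 14 * x * a - 42 * x * b + 56 * a * b - 28 * b ^ 2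
def cqa {K : Type*} [CommRing K] (x a b : K) : K := -7 * x ^ 2 + 56 * x * b - 56 * a * b + 28 * b ^ 2
def cqb {K : Type*} [CommRing K] (x a b : K) : K :=
  -21 * x ^ 2 + 56 * x * a - 56 * x * b - 28 * a ^ 2 + 56 * a * b - 24 * b ^ 2

/-- Partial derivatives of `f = a R² - b q²`. -/
def fx {K : Type*} [CommRing K] (x a b : K) : K := 2 * a * cR x a * cRx x a - 2 * b * cq x a b * cqx x a b
def fa {K : Type*} [CommRing K] (x a b : K) : K :=
  cR x a ^ 2 + 2 * a * cR x a * cRa x a - 2 * b * cq x a b * cqa x a b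
def fb {K : Type*} [CommRing K] (x a b : K) : K := -cq x a b ^ 2 - 2 * b * cq x a b * cqb x a b

def fxx {K : Type*} [CommRing K] (x a b : K) : K :=
  2 * a * (cRx x a ^ 2 + cR x a * (42 * x - 56 * a))
    - 2 * b * (cqx x a b ^ 2 + cq x a b * (42 * x - 14 * a - 42 * b))
def fxb {K : Type*} [CommRing K] (x a b : K) : K :=
  -2 * cq x a b * cqx x a b
    - 2 * b * (cqb x a b * cqx x a b + cq x a b * (-42 * x + 56 * a - 56 * b))
def fbb {K : Type*} [CommRing K] (x a b : K) : K :=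
  -4 * cq x a b * cqb x a b
    - 2 * b * (cqb x a b ^ 2 + cq x a b * (-56 * x + 56 * a - 48 * b))

/-- The septic in the new coordinates, as a polynomial. -/
noncomputable def Fpoly (p r : ℂ) : MvPolynomial (Fin 3) ℂ :=
  (X 0 - X 1) * cR (X 0) (X 0 - X 1) ^ 2
    - (C p * X 1 + C r * X 2) * cq (X 0) (X 0 - X 1) (C p * X 1 + C r * X 2) ^ 2

lemma Q_eq (α : ℂ) (hα : 7 * α ^ 3 + 7 * α + 1 = 0) (x z w : ℂ) :
    (-(12 / 7) * α ^ 2 - (384 / 49) * α - 8 / 7) * z ^ 3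
      + (-(32 / 7) * α ^ 2 + (24 / 49) * α - 4) * z ^ 2 * w
      + (-4 * α ^ 2 + (24 / 49) * α - 4) * z * w ^ 2
      + (-(8 / 7) * α ^ 2 + (8 / 49) * α - 8 / 7) * w ^ 3 + (z + w) * x ^ 2
    = -α * cq x (x - z) (α ^ 2 * z + (α ^ 2 + 1) * w) := by
  unfold cq
  linear_combination (((-8/7) + (8/49)*α^1 + (-20/7)*α^2 + (-8/7)*α^4)*z^3
    + ((-4) + (24/49)*α^1 + (-8)*α^2 + (-24/7)*α^4)*z^2*w^1
    + ((-4) + (24/49)*α^1 + (-52/7)*α^2 + (-24/7)*α^4)*z^1*w^2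
    + ((-8/7) + (8/49)*α^1 + (-16/7)*α^2 + (-8/7)*α^4)*w^3
    + x^2*z + x^2*w) * hα

lemma Sy_eq (α : ℂ) (hα : 7 * α ^ 3 + 7 * α + 1 = 0) :
    (aeval (![X 0, 0, X 1, X 2] : Fin 4 → MvPolynomial (Fin 3) ℂ)
      (Psept - Usept (-(12 / 7) * α ^ 2 - (384 / 49) * α - 8 / 7)
        (-(32 / 7) * α ^ 2 + (24 / 49) * α - 4) (-4 * α ^ 2 + (24 / 49) * α - 4)
        (-(8 / 7) * α ^ 2 + (8 / 49) * α - 8 / 7) (49 * α ^ 2 - 7 * α + 50)))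
      = Fpoly (α ^ 2) (α ^ 2 + 1) := by
  apply MvPolynomial.funext
  intro v
  have h := Q_eq α hα (v 0) (v 1) (v 2)
  have hB : α ^ 2 * (v 1 + (49 * α ^ 2 - 7 * α + 50) * v 2)
      = α ^ 2 * v 1 + (α ^ 2 + 1) * v 2 := by
    linear_combination (7 * α - 1) * v 2 * hα
  have hl : eval v (aeval (![X 0, 0, X 1, X 2] : Fin 4 → MvPolynomial (Fin 3) ℂ)
      (Psept - Usept (-(12 / 7) * α ^ 2 - (384 / 49) * α - 8 / 7)
        (-(32 / 7) * α ^ 2 + (24 / 49) * α - 4) (-4 * α ^ 2 + (24 / 49) * α - 4)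
        (-(8 / 7) * α ^ 2 + (8 / 49) * α - 8 / 7) (49 * α ^ 2 - 7 * α + 50)))
      = (v 0 - v 1) * cR (v 0) (v 0 - v 1) ^ 2 -
        (v 1 + (49 * α ^ 2 - 7 * α + 50) * v 2) *
        ((-(12 / 7) * α ^ 2 - (384 / 49) * α - 8 / 7) * v 1 ^ 3
      + (-(32 / 7) * α ^ 2 + (24 / 49) * α - 4) * v 1 ^ 2 * v 2
      + (-4 * α ^ 2 + (24 / 49) * α - 4) * v 1 * v 2 ^ 2
      + (-(8 / 7) * α ^ 2 + (8 / 49) * α - 8 / 7) * v 2 ^ 3 + (v 1 + v 2) * v 0 ^ 2) ^ 2 := by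
    have h2 : ∀ g : MvPolynomial (Fin 4) ℂ,
        eval v (aeval (![X 0, 0, X 1, X 2] : Fin 4 → MvPolynomial (Fin 3) ℂ) g)
          = eval ![v 0, 0, v 1, v 2] g := by
      intro g
      rw [aeval_def, eval₂_eq_eval_map, ← coe_aeval_eq_eval]
      induction g using MvPolynomial.induction_on with
      | C a => simp
      | add p q hp hq => simp_all
      | mul_X p i hp => 
        simp only [map_mul, hp, map_X, eval_X]
        congr 1
        fin_cases i <;> simp
    rw [h2]
    simp only [Psept, Usept, cR, map_sub, map_add, map_mul, map_pow, eval_X, eval_C, map_ofNat]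
    simp
    ring
  rw [hl, h]
  have hr : eval v (Fpoly (α ^ 2) (α ^ 2 + 1)) = (v 0 - v 1) * cR (v 0) (v 0 - v 1) ^ 2
      - (α ^ 2 * v 1 + (α ^ 2 + 1) * v 2)
        * cq (v 0) (v 0 - v 1) (α ^ 2 * v 1 + (α ^ 2 + 1) * v 2) ^ 2 := by
    simp only [Fpoly, cR, cq, map_sub, map_add, map_mul, map_pow, eval_X, eval_C, map_ofNat,
      map_one]
  rw [hr, ← hB]
  ring

section derivs
variable (p r : ℂ)

/-- The new coordinate functions as polynomials. -/
noncomputable def Ap : MvPolynomial (Fin 3) ℂ := X 0 - X 1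
noncomputable def Bp : MvPolynomial (Fin 3) ℂ := C p * X 1 + C r * X 2

lemma d0x : pderiv 0 (X 0 : MvPolynomial (Fin 3) ℂ) = 1 := by simp
lemma d1x : pderiv 1 (X 0 : MvPolynomial (Fin 3) ℂ) = 0 := by simp [pderiv_X]
lemma d2x : pderiv 2 (X 0 : MvPolynomial (Fin 3) ℂ) = 0 := by simp [pderiv_X]
lemma d0a : pderiv 0 Ap = 1 := by simp [Ap, pderiv_X]
lemma d1a : pderiv 1 Ap = -1 := by simp [Ap, pderiv_X]
lemma d2a : pderiv 2 Ap = 0 := by simp [Ap, pderiv_X]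
lemma d0b : pderiv 0 (Bp p r) = 0 := by simp [Bp, pderiv_X]
lemma d1b : pderiv 1 (Bp p r) = C p := by simp [Bp, pderiv_X]
lemma d2b : pderiv 2 (Bp p r) = C r := by simp [Bp, pderiv_X]

lemma Fpoly_eq : Fpoly p r = Ap * cR (X 0) Ap ^ 2 - Bp p r * cq (X 0) Ap (Bp p r) ^ 2 := rfl

lemma dnat (i : Fin 3) (n : ℕ) [n.AtLeastTwo] :
    pderiv i (ofNat(n) : MvPolynomial (Fin 3) ℂ) = 0 := by
  exact (pderiv i).map_natCast n

lemma dC (i : Fin 3) (c : ℂ) : pderiv i (C c : MvPolynomial (Fin 3) ℂ) = 0 := pderiv_C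

/-- Chain rule for `R`. -/
lemma dR (i : Fin 3) (x a : MvPolynomial (Fin 3) ℂ) :
    pderiv i (cR x a) = cRx x a * pderiv i x + cRa x a * pderiv i a := by
  simp only [cR, cRx, cRa, map_sub, map_add, Derivation.leibniz, Derivation.leibniz_pow, dnat,
    smul_eq_mul, nsmul_eq_mul]
  push_cast
  ring

lemma dq (i : Fin 3) (x a b : MvPolynomial (Fin 3) ℂ) :
    pderiv i (cq x a b)
      = cqx x a b * pderiv i x + cqa x a b * pderiv i a + cqb x a b * pderiv i b := by
  simp only [cq, cqx, cqa, cqb, map_sub, map_add, Derivation.leibniz, Derivation.leibniz_pow, dnat,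
    smul_eq_mul, nsmul_eq_mul]
  push_cast
  ring

lemma dF (i : Fin 3) : pderiv i (Fpoly p r)
    = fx (X 0) Ap (Bp p r) * pderiv i (X 0) + fa (X 0) Ap (Bp p r) * pderiv i Ap
      + fb (X 0) Ap (Bp p r) * pderiv i (Bp p r) := by
  simp only [Fpoly_eq, map_sub, Derivation.leibniz, Derivation.leibniz_pow, dR, dq,
    smul_eq_mul, nsmul_eq_mul, fx, fa, fb]
  push_cast
  ring

lemma dF0 : pderiv 0 (Fpoly p r) = fx (X 0) Ap (Bp p r) + fa (X 0) Ap (Bp p r) := by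
  rw [dF, d0x, d0a, d0b]; ring
lemma dF1 : pderiv 1 (Fpoly p r) = -fa (X 0) Ap (Bp p r) + C p * fb (X 0) Ap (Bp p r) := by
  rw [dF, d1x, d1a, d1b]; ring
lemma dF2 : pderiv 2 (Fpoly p r) = C r * fb (X 0) Ap (Bp p r) := by
  rw [dF, d2x, d2a, d2b]; ring

lemma euler1 : X 0 * pderiv 0 (Fpoly p r) + X 1 * pderiv 1 (Fpoly p r)
    + X 2 * pderiv 2 (Fpoly p r) = 7 * Fpoly p r := by
  have h : X 0 * pderiv 0 (Fpoly p r) + X 1 * pderiv 1 (Fpoly p r)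
      + X 2 * pderiv 2 (Fpoly p r) = X 0 * fx (X 0) Ap (Bp p r) + Ap * fa (X 0) Ap (Bp p r)
        + Bp p r * fb (X 0) Ap (Bp p r) := by
    rw [dF0, dF1, dF2]
    generalize fx (X 0) Ap (Bp p r) = u1
    generalize fa (X 0) Ap (Bp p r) = u2
    generalize fb (X 0) Ap (Bp p r) = u3
    unfold Ap Bp
    ring
  rw [h, Fpoly_eq]
  generalize Ap = a
  generalize Bp p r = b
  simp only [fx, fa, fb, cR, cq, cRx, cRa, cqx, cqa, cqb]
  ring

/-- Differentiated Euler relation: `H v = 6 ∇F`. -/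
lemma euler2 (i : Fin 3) : X 0 * pderiv i (pderiv 0 (Fpoly p r))
    + X 1 * pderiv i (pderiv 1 (Fpoly p r)) + X 2 * pderiv i (pderiv 2 (Fpoly p r))
    = 6 * pderiv i (Fpoly p r) := by
  have h := congrArg (pderiv i) (euler1 p r)
  simp only [map_add, Derivation.leibniz, dnat, smul_eq_mul] at h
  have h3 : pderiv 0 (Fpoly p r) * pderiv i (X 0) + pderiv 1 (Fpoly p r) * pderiv i (X 1)
      + pderiv 2 (Fpoly p r) * pderiv i (X 2) = pderiv i (Fpoly p r) := by
    fin_cases i <;> simp [pderiv_X]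
  linear_combination h - h3

/-- Derivatives of `fx`, `fb` along directions on which `a` is constant. -/
lemma dfx (x a b : MvPolynomial (Fin 3) ℂ) : ∃ g, ∀ i, pderiv i (fx x a b)
    = fxx x a b * pderiv i x + g * pderiv i a + fxb x a b * pderiv i b := by
  refine ⟨2 * cR x a * cRx x a + 2 * a * (cRa x a * cRx x a + cR x a * (-56 * x + 56 * a))
    - 2 * b * (cqa x a b * cqx x a b + cq x a b * (-14 * x + 56 * b)), ?_⟩
  intro i
  simp only [fx, fxx, fxb, map_sub, Derivation.leibniz, Derivation.leibniz_pow, dR, dq, dnat,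
    smul_eq_mul, nsmul_eq_mul]
  have h1 : pderiv i (cRx x a) = (42 * x - 56 * a) * pderiv i x
      + (-56 * x + 56 * a) * pderiv i a := by
    simp only [cRx, map_sub, map_add, Derivation.leibniz, Derivation.leibniz_pow, dnat,
      smul_eq_mul, nsmul_eq_mul]
    push_cast
    ring
  have h2 : pderiv i (cqx x a b) = (42 * x - 14 * a - 42 * b) * pderiv i x
      + (-14 * x + 56 * b) * pderiv i a + (-42 * x + 56 * a - 56 * b) * pderiv i b := by
    simp only [cqx, map_sub, map_add, Derivation.leibniz, Derivation.leibniz_pow, dnat,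
      smul_eq_mul, nsmul_eq_mul]
    push_cast
    ring
  rw [h1, h2]
  ring

lemma dfb (x a b : MvPolynomial (Fin 3) ℂ) : ∃ g, ∀ i, pderiv i (fb x a b)
    = fxb x a b * pderiv i x + g * pderiv i a + fbb x a b * pderiv i b := by
  refine ⟨-2 * cq x a b * cqa x a b
    - 2 * b * (cqa x a b * cqb x a b + cq x a b * (56 * x - 56 * a + 56 * b)), ?_⟩
  intro i
  simp only [fb, fbb, fxb, map_sub, map_neg, Derivation.leibniz, Derivation.leibniz_pow, dR, dq,
    dnat, smul_eq_mul, nsmul_eq_mul]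
  have h2 : pderiv i (cqb x a b) = (-42 * x + 56 * a - 56 * b) * pderiv i x
      + (56 * x - 56 * a + 56 * b) * pderiv i a + (-56 * x + 56 * a - 48 * b) * pderiv i b := by
    simp only [cqb, map_sub, map_add, map_neg, Derivation.leibniz, Derivation.leibniz_pow, dnat,
      smul_eq_mul, nsmul_eq_mul]
    push_cast
    ring
  rw [h2]
  push_cast
  ring

/-- `r ∂₀F + r ∂₁F - p ∂₂F = r fx`. -/
lemma dir1 : C r * pderiv 0 (Fpoly p r) + C r * pderiv 1 (Fpoly p r)
    - C p * pderiv 2 (Fpoly p r) = C r * fx (X 0) Ap (Bp p r) := by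
  rw [dF0, dF1, dF2]; ring

lemma dir11 : C r * pderiv 0 (fx (X 0) Ap (Bp p r)) + C r * pderiv 1 (fx (X 0) Ap (Bp p r))
    - C p * pderiv 2 (fx (X 0) Ap (Bp p r)) = C r * fxx (X 0) Ap (Bp p r) := by
  obtain ⟨g, hg⟩ := dfx (X 0) Ap (Bp p r)
  rw [hg, hg, hg, d0x, d0a, d0b, d1x, d1a, d1b, d2x, d2a, d2b]
  ring

lemma hess_rank (v : Fin 3 → ℂ) (hv : v ≠ 0) (hr : r ≠ 0)
    (hJ : ∀ i, eval v (pderiv i (Fpoly p r)) = 0) (x a b : ℂ) (hx : v 0 = x)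
    (ha : v 0 - v 1 = a) (hb : p * v 1 + r * v 2 = b)
    (hdet : fxx x a b * fbb x a b - fxb x a b ^ 2 ≠ 0) :
    (hessianAt (Fpoly p r) v).rank = 2 := by
  set H := hessianAt (Fpoly p r) v with hH
  have hHe : ∀ i j, H i j = eval v (pderiv i (pderiv j (Fpoly p r))) := fun i j => rfl
  have evA : eval v Ap = a := by simp [Ap, ha]
  have evB : eval v (Bp p r) = b := by simp [Bp, hb]
  have evX : eval v (X 0 : MvPolynomial (Fin 3) ℂ) = x := by simp [hx]
  have exx : eval v (fxx (X 0) Ap (Bp p r)) = fxx x a b := by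
    simp only [fxx, cR, cRx, cq, cqx, map_sub, map_add, map_mul, map_pow, map_neg, map_ofNat,
      evA, evB, evX]
  have exb : eval v (fxb (X 0) Ap (Bp p r)) = fxb x a b := by
    simp only [fxb, cq, cqx, cqb, map_sub, map_add, map_mul, map_pow, map_neg, map_ofNat,
      evA, evB, evX]
  have ebb : eval v (fbb (X 0) Ap (Bp p r)) = fbb x a b := by
    simp only [fbb, cq, cqb, map_sub, map_add, map_mul, map_pow, map_neg, map_ofNat,
      evA, evB, evX]
  -- the three entries of the restricted form
  obtain ⟨g, hg⟩ := dfx (X 0) Ap (Bp p r)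
  obtain ⟨k, hk⟩ := dfb (X 0) Ap (Bp p r)
  have row : ∀ i, r * H i 0 + r * H i 1 - p * H i 2
      = r * eval v (pderiv i (fx (X 0) Ap (Bp p r))) := by
    intro i
    have h := congrArg (fun t => eval v (pderiv i t)) (dir1 p r)
    simp only [map_sub, map_add, Derivation.leibniz, dC, smul_eq_mul, mul_zero, add_zero,
      map_mul, eval_C] at h
    simpa only [hHe] using h
  have row2 : ∀ i, H i 2 = r * eval v (pderiv i (fb (X 0) Ap (Bp p r))) := by
    intro i
    rw [hHe, dF2]
    simp only [Derivation.leibniz, dC, smul_eq_mul, mul_zero, add_zero, map_mul, eval_C]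
  have h11 : r * (r * H 0 0 + r * H 0 1 - p * H 0 2) + r * (r * H 1 0 + r * H 1 1 - p * H 1 2)
      - p * (r * H 2 0 + r * H 2 1 - p * H 2 2) = r ^ 2 * fxx x a b := by
    have h := congrArg (eval v) (dir11 p r)
    simp only [map_sub, map_add, map_mul, eval_C, exx] at h
    rw [row, row, row]
    linear_combination r * h
  have h21 : r * H 2 0 + r * H 2 1 - p * H 2 2 = r ^ 2 * fxb x a b := by
    rw [row, hg, d2x, d2a, d2b]
    simp only [map_add, map_mul, map_zero, mul_zero, eval_C, exb]
    ring
  have h12 : r * H 0 2 + r * H 1 2 - p * H 2 2 = r ^ 2 * fxb x a b := by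
    rw [row2, row2, row2, hk, hk, hk, d0x, d0a, d0b, d1x, d1a, d1b, d2x, d2a, d2b]
    simp only [map_add, map_mul, map_zero, map_one, map_neg, mul_zero, eval_C, exb]
    ring
  have h22 : H 2 2 = r ^ 2 * fbb x a b := by
    rw [row2, hk, d2x, d2a, d2b]
    simp only [map_add, map_mul, map_zero, mul_zero, eval_C, ebb]
    ring
  apply le_antisymm
  · -- the vector `v` lies in the kernel
    have hker : H.mulVec v = 0 := by
      funext i
      have h := congrArg (eval v) (euler2 p r i)
      simp only [map_add, map_mul, eval_X, map_ofNat, hJ, mul_zero] at h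
      simp only [Matrix.mulVec, dotProduct, Fin.sum_univ_three, hHe, Pi.zero_apply]
      linear_combination h
    have hne : H.rank ≠ 3 := by
      intro h3
      have h4 := LinearMap.finrank_range_add_finrank_ker H.mulVecLin
      have h5 : Module.finrank ℂ (LinearMap.range H.mulVecLin) = 3 := h3
      rw [h5, Module.finrank_fin_fun] at h4
      have h6 : LinearMap.ker H.mulVecLin = ⊥ := Submodule.finrank_eq_zero.mp (by omega)
      have h7 : v ∈ LinearMap.ker H.mulVecLin := by
        rw [LinearMap.mem_ker, Matrix.mulVecLin_apply, hker]
      rw [h6, Submodule.mem_bot] at h7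
      exact hv h7
    have hle : H.rank ≤ 3 := by simpa using H.rank_le_card_width
    omega
  · let N : Matrix (Fin 3) (Fin 2) ℂ := !![r, 0; r, 0; -p, 1]
    have hN : N.transpose * H * N = !![r ^ 2 * fxx x a b, r ^ 2 * fxb x a b;
        r ^ 2 * fxb x a b, r ^ 2 * fbb x a b] := by
      ext i j
      fin_cases i <;> fin_cases j <;>
        simp [N, Matrix.mul_apply, Fin.sum_univ_three]
      · linear_combination h11
      · linear_combination h12
      · linear_combination h21
      · linear_combination h22
    have hu : IsUnit (N.transpose * H * N) := by
      rw [Matrix.isUnit_iff_isUnit_det, hN, Matrix.det_fin_two_of, isUnit_iff_ne_zero]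
      have : r ^ 2 * fxx x a b * (r ^ 2 * fbb x a b) - r ^ 2 * fxb x a b * (r ^ 2 * fxb x a b)
          = r ^ 4 * (fxx x a b * fbb x a b - fxb x a b ^ 2) := by ring
      rw [this]
      exact mul_ne_zero (pow_ne_zero _ hr) hdet
    have h2 : (N.transpose * H * N).rank = 2 := by
      rw [Matrix.rank_of_isUnit _ hu]; simp
    calc 2 = (N.transpose * H * N).rank := h2.symm
      _ ≤ (N.transpose * H).rank := Matrix.rank_mul_le_left _ _
      _ ≤ H.rank := Matrix.rank_mul_le_right _ _

end derivs

/-- A cubic without multiple roots has exactly three complex roots. -/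
lemma cubic_ncard (c3 c2 c1 c0 : ℂ) (h3 : c3 ≠ 0)
    (hsep : ∀ x, c3 * x ^ 3 + c2 * x ^ 2 + c1 * x + c0 = 0 →
      3 * c3 * x ^ 2 + 2 * c2 * x + c1 ≠ 0) :
    {x : ℂ | c3 * x ^ 3 + c2 * x ^ 2 + c1 * x + c0 = 0}.ncard = 3 := by
  classical
  set P : Polynomial ℂ := Polynomial.C c3 * Polynomial.X ^ 3 + Polynomial.C c2 * Polynomial.X ^ 2
    + Polynomial.C c1 * Polynomial.X + Polynomial.C c0 with hP
  have hdeg : P.natDegree = 3 := Polynomial.natDegree_cubic h3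
  have hP0 : P ≠ 0 := by
    intro h
    rw [h] at hdeg
    simp at hdeg
  have hev : ∀ x, P.eval x = c3 * x ^ 3 + c2 * x ^ 2 + c1 * x + c0 := by
    intro x; simp [hP]
  have hdev : ∀ x, P.derivative.eval x = 3 * c3 * x ^ 2 + 2 * c2 * x + c1 := by
    intro x; simp [hP]; ring
  have hset : {x : ℂ | c3 * x ^ 3 + c2 * x ^ 2 + c1 * x + c0 = 0} = ↑P.roots.toFinset := by
    ext x
    simp [hP0, Polynomial.IsRoot, hev]
  have hnd : P.roots.Nodup := by
    rw [Multiset.nodup_iff_count_le_one]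
    intro x
    rw [Polynomial.count_roots]
    by_contra hlt
    push Not at hlt
    rw [Polynomial.one_lt_rootMultiplicity_iff_isRoot hP0] at hlt
    obtain ⟨h1, h2⟩ := hlt
    rw [Polynomial.IsRoot, hev] at h1
    rw [Polynomial.IsRoot, hdev] at h2
    exact hsep x h1 h2
  rw [hset, Set.ncard_coe_finset, Multiset.toFinset_card_of_nodup hnd,
    ← (IsAlgClosed.splits P).natDegree_eq_card_roots, hdeg]

/-- Roots of `R` (in the chart `a = 1`). -/
def Z1 : Set ℂ := {x | 7 * x ^ 3 + (-28) * x ^ 2 + 28 * x + (-8) = 0}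
def Z4 : Set ℂ := {x | 1 * x ^ 3 + (-3) * x ^ 2 + (-4) * x + (-1) = 0}
def Z5 : Set ℂ := {x | 1 * x ^ 3 + (-10) * x ^ 2 + 4 * x + 0 = 0}

lemma Z1_ncard : Z1.ncard = 3 := by
  apply cubic_ncard _ _ _ _ (by norm_num)
  intro x hp hq
  apply one_ne_zero (α := ℂ)
  linear_combination ((41/8) + (-21/8)*x^1 )*hp + ( (3/2) + (-23/8)*x^1 + (7/8)*x^2 )*hq

lemma Z4_ncard : Z4.ncard = 3 := by
  apply cubic_ncard _ _ _ _ (by norm_num)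
  intro x hp hq
  apply one_ne_zero (α := ℂ)
  linear_combination ((45/7) + (-18/7)*x^1 )*hp + ( (-13/7) + (-3)*x^1 + (6/7)*x^2 )*hq

lemma Z5_ncard : Z5.ncard = 3 := by
  apply cubic_ncard _ _ _ _ (by norm_num)
  intro x hp hq
  apply one_ne_zero (α := ℂ)
  linear_combination ((425/168) + (-11/28)*x^1 )*hp + ( (1/4) + (-215/168)*x^1 + (11/84)*x^2 )*hq

noncomputable def b1 (x : ℂ) : ℂ := 4 - 7 * x + 7 / 4 * x ^ 2
noncomputable def b2 (x : ℂ) : ℂ := -(3 / 2) + 7 / 2 * x - 7 / 4 * x ^ 2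

def T1 : Set (ℂ × ℂ) := (fun x => (x, 1)) '' Z1
noncomputable def T2 : Set (ℂ × ℂ) := (fun x => (x, b1 x)) '' Z1
noncomputable def T3 : Set (ℂ × ℂ) := (fun x => (x, b2 x)) '' Z1
noncomputable def T4 : Set (ℂ × ℂ) := (fun s => (-2 * s, s ^ 2)) '' Z4
def T5 : Set (ℂ × ℂ) := (fun x => (x, 1)) '' Z5

/-- The fifteen singular points `(x, b)` in the chart `a = 1`. -/
noncomputable def T : Set (ℂ × ℂ) := T1 ∪ T2 ∪ T3 ∪ T4 ∪ T5

lemma img_ncard (Z : Set ℂ) (hZ : Z.ncard = 3) (f : ℂ → ℂ × ℂ) (hf : Function.Injective f) :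
    (f '' Z).ncard = 3 := by
  rw [Set.ncard_image_of_injective _ hf, hZ]

lemma T_ncard : T.ncard = 15 := by
  have n1 : T1.ncard = 3 := img_ncard _ Z1_ncard _ (fun x y h => (Prod.mk.inj h).1)
  have n2 : T2.ncard = 3 := img_ncard _ Z1_ncard _ (fun x y h => (Prod.mk.inj h).1)
  have n3 : T3.ncard = 3 := img_ncard _ Z1_ncard _ (fun x y h => (Prod.mk.inj h).1)
  have n5 : T5.ncard = 3 := img_ncard _ Z5_ncard _ (fun x y h => (Prod.mk.inj h).1)
  have n4 : T4.ncard = 3 := img_ncard _ Z4_ncard _ (fun x y h => by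
    have := (Prod.mk.inj h).1
    linear_combination (-1 / 2) * this)
  have fin : ∀ S : Set (ℂ × ℂ), S.ncard = 3 → S.Finite := fun S h =>
    Set.finite_of_ncard_ne_zero (by omega)
  have f1 := fin _ n1
  have f2 := fin _ n2
  have f3 := fin _ n3
  have f4 := fin _ n4
  have f5 := fin _ n5
  have d12 : Disjoint T1 T2 := by
    rw [Set.disjoint_left]
    rintro _ ⟨x, hp, rfl⟩ ⟨y, hy, h⟩
    simp only [Prod.mk.injEq] at h
    obtain ⟨rfl, hq⟩ := h
    simp only [b1, Z1, Set.mem_setOf_eq] at hq hp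
    apply one_ne_zero (α := ℂ)
    linear_combination ((-49/8) + (7/4)*y^1 )*hp + ( (-16) + (49/2)*y^1 + (-7)*y^2 )*hq
  have d13 : Disjoint T1 T3 := by
    rw [Set.disjoint_left]
    rintro _ ⟨x, hp, rfl⟩ ⟨y, hy, h⟩
    simp only [Prod.mk.injEq] at h
    obtain ⟨rfl, hq⟩ := h
    simp only [b2, Z1, Set.mem_setOf_eq] at hq hp
    apply one_ne_zero (α := ℂ)
    linear_combination ((-7/41) + (35/164)*y^1 )*hp + ( (6/41) + (-98/41)*y^1 + (35/41)*y^2 )*hq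
  have d23 : Disjoint T2 T3 := by
    rw [Set.disjoint_left]
    rintro _ ⟨x, hp, rfl⟩ ⟨y, hy, h⟩
    simp only [Prod.mk.injEq] at h
    obtain ⟨rfl, hq⟩ := h
    simp only [b1, b2, Z1, Set.mem_setOf_eq] at hq hp
    apply one_ne_zero (α := ℂ)
    linear_combination ((63/13) + (-28/13)*y^1 )*hp - ( (94/13) + (-14)*y^1 + (56/13)*y^2 )*hq
  -- the first coordinates of `T4`, `T5` and `T1 ∪ T2 ∪ T3` are different
  have m123 : ∀ u ∈ T1 ∪ T2 ∪ T3, u.1 ∈ Z1 := by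
    rintro u ((⟨x, hp, rfl⟩ | ⟨x, hp, rfl⟩) | ⟨x, hp, rfl⟩) <;> exact hp
  have d4 : Disjoint (T1 ∪ T2 ∪ T3) T4 := by
    rw [Set.disjoint_left]
    rintro u hu ⟨s, hp, rfl⟩
    have hq := m123 _ hu
    simp only [Z1, Z4, Set.mem_setOf_eq] at hq hp
    apply one_ne_zero (α := ℂ)
    linear_combination ((-777/13) + (-245)*s^1 + (-1960/13)*s^2 )*hp
      + ( (191/26) + (945/104)*s^1 + (-35/13)*s^2 )*hq
  have d5 : Disjoint (T1 ∪ T2 ∪ T3 ∪ T4) T5 := by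
    rw [Set.disjoint_left]
    rintro u (hu | ⟨s, hp, rfl⟩) ⟨x, hx, hxu⟩
    · have hp := m123 _ hu
      rw [← hxu] at hp
      simp only [Z1, Z5, Set.mem_setOf_eq] at hx hp
      apply one_ne_zero (α := ℂ)
      linear_combination ((-1/8) + (-2205/656)*x^1 + (231/656)*x^2 )*hp
        + ( (-959/164) + (5733/656)*x^1 + (-1617/656)*x^2 )*hx
    · simp only [Prod.mk.injEq] at hxu
      obtain ⟨rfl, -⟩ := hxu
      simp only [Z4, Z5, Set.mem_setOf_eq] at hx hp
      apply one_ne_zero (α := ℂ)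
      linear_combination ((-1) + (80/7)*s^1 + (17/7)*s^2 )*hp
        + ( (-13/14) + (-1)*s^1 + (17/56)*s^2 )*hx
  have d3 : Disjoint (T1 ∪ T2) T3 := Set.disjoint_union_left.mpr ⟨d13, d23⟩
  unfold T
  rw [Set.ncard_union_eq d5 (((f1.union f2).union f3).union f4) f5,
    Set.ncard_union_eq d4 ((f1.union f2).union f3) f4,
    Set.ncard_union_eq d3 (f1.union f2) f3, Set.ncard_union_eq d12 f1 f2, n1, n2, n3, n4, n5]

/-- Euler's relation for `f` in the chart `a = 1`. -/
lemma euler_f (x a b : ℂ) : x * fx x a b + a * fa x a b + b * fb x a b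
    = 7 * (a * cR x a ^ 2 - b * cq x a b ^ 2) := by
  simp only [fx, fa, fb, cR, cq, cRx, cRa, cqx, cqa, cqb]
  ring

/-- `G = R - s q` factors as `(1 - s) H`. -/
def hH (x s : ℂ) : ℂ := 7 * x ^ 3 + (-28 - 21 * s - 21 * s ^ 2) * x ^ 2
  + (28 + 28 * s + 28 * s ^ 2 - 28 * s ^ 3 - 28 * s ^ 4) * x
  + (-8 - 8 * s - 8 * s ^ 2 + 20 * s ^ 3 + 20 * s ^ 4 - 8 * s ^ 5 - 8 * s ^ 6)
def hHx (x s : ℂ) : ℂ := 21 * x ^ 2 + 2 * (-28 - 21 * s - 21 * s ^ 2) * x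
  + (28 + 28 * s + 28 * s ^ 2 - 28 * s ^ 3 - 28 * s ^ 4)
def hHs (x s : ℂ) : ℂ := (-21 - 42 * s) * x ^ 2
  + (28 + 56 * s - 84 * s ^ 2 - 112 * s ^ 3) * x
  + (-8 - 16 * s + 60 * s ^ 2 + 80 * s ^ 3 - 40 * s ^ 4 - 48 * s ^ 5)

lemma H_lin (x s : ℂ) (h : hH x s = 0) (hx : hHx x s = 0) (hs : hHs x s = 0) :
    x = -2 * s := by
  unfold hH at h
  unfold hHx at hx
  unfold hHs at hs
  linear_combination ((6817/1820) + (-1828/455)*s^1 + (-3677/1820)*s^2 + (1055/364)*s^3 + (-17/910)*s^4 +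
      (-8703/3640)*x^1 + (447/91)*x^1*s^1) * h
    + ((2879/2730) + (-1718/1365)*s^1 + (-1369/2730)*s^2 + (1427/1365)*s^3 + (29/910)*s^4 +
      (2/273)*s^5 + (-11993/5460)*x^1 + (4141/1365)*x^1*s^1 + (667/780)*x^1*s^2 +
      (-2627/2730)*x^1*s^3 + (17/2730)*x^1*s^4 + (2901/3640)*x^2 + (-149/91)*x^2*s^1) * hx
    + ((-149/2730) + (-1061/1820)*s^1 + (211/364)*s^2 + (1277/5460)*s^3 + (-443/910)*s^4 +
      (17/5460)*s^5 + (313/2730)*x^1 + (863/10920)*x^1*s^1 + (-2973/3640)*x^1*s^2) * hs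

lemma H_cub (x s : ℂ) (h : hH x s = 0) (hx : hHx x s = 0) (hs : hHs x s = 0) :
    1 * s ^ 3 + (-3) * s ^ 2 + (-4) * s + (-1) = 0 := by
  unfold hH at h
  unfold hHx at hx
  unfold hHs at hs
  linear_combination ((-2969/455) + (-1327/910)*s^1 + (9227/3640)*s^2 + (499/364)*s^3 + (-187/455)*s^4 +
      (16599/3640)*x^1 + (-15/26)*x^1*s^1) * h
    + ((-9889/5460) + (-9/260)*s^1 + (2749/5460)*s^2 + (-2669/5460)*s^3 + (-538/1365)*s^4 +
      (44/273)*s^5 + (1471/390)*x^1 + (207/3640)*x^1*s^1 + (-2851/2730)*x^1*s^2 +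
      (-2033/5460)*x^1*s^3 + (187/1365)*x^1*s^4 + (-5533/3640)*x^2 + (5/26)*x^2*s^1) * hx
    + ((1699/5460) + (7649/5460)*s^1 + (359/546)*s^2 + (-1139/3640)*s^3 + (-3397/10920)*s^4 +
      (187/2730)*s^5 + (-587/1365)*x^1 + (-4547/5460)*x^1*s^1 + (9/65)*x^1*s^2) * hs

/-- Classification of the singular points in the chart `a = 1`. -/
lemma classify (x b : ℂ) (hx : fx x 1 b = 0) (ha : fa x 1 b = 0) (hb : fb x 1 b = 0) :
    (x, b) ∈ T := by
  have he := euler_f x 1 b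
  rw [hx, ha, hb] at he
  have he' : cR x 1 ^ 2 = b * cq x 1 b ^ 2 := by linear_combination (-1 / 7) * he
  by_cases hR : cR x 1 = 0
  · have hq : cq x 1 b = 0 := by
      by_contra hq
      have hb0 : b = 0 := by
        rw [hR] at he'
        have h0 : b * cq x 1 b ^ 2 = 0 := by rw [← he']; ring
        exact (mul_eq_zero.mp h0).resolve_right (pow_ne_zero _ hq)
      have h1 : cq x 1 b ^ 2 = 0 := by
        unfold fb at hb
        rw [hb0] at hb ⊢
        linear_combination -hb
      exact hq (by simpa using h1)
    have hZ : x ∈ Z1 := by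
      show 7 * x ^ 3 + (-28) * x ^ 2 + 28 * x + (-8) = 0
      unfold cR at hR
      linear_combination hR
    have hfac : (b - 1) * ((b - b1 x) * (b - b2 x)) = 0 := by
      simp only [cR, cq, b1, b2] at hR hq ⊢
      linear_combination (-1 / 8) * hq + (1 / 8 + (b - 1) * (7 / 8 - 7 / 16 * x)) * hR
    rcases mul_eq_zero.mp hfac with h | h
    · left; left; left; left
      exact ⟨x, hZ, by rw [sub_eq_zero.mp h]⟩
    rcases mul_eq_zero.mp h with h | h
    · left; left; left; right
      exact ⟨x, hZ, by rw [sub_eq_zero.mp h]⟩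
    · left; left; right
      exact ⟨x, hZ, by rw [sub_eq_zero.mp h]⟩
  · have hq : cq x 1 b ≠ 0 := by
      intro h
      rw [h] at he'
      exact hR (by simpa using he')
    obtain ⟨s, hs⟩ : ∃ s, s = cR x 1 / cq x 1 b := ⟨_, rfl⟩
    have hsq : cR x 1 = s * cq x 1 b := by rw [hs]; field_simp
    have hbs : b = s ^ 2 := by
      rw [hsq] at he'
      have h1 : (b - s ^ 2) * cq x 1 b ^ 2 = 0 := by linear_combination -he'
      exact sub_eq_zero.mp ((mul_eq_zero.mp h1).resolve_right (pow_ne_zero _ hq))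
    have hs0 : s ≠ 0 := by
      intro h
      rw [h] at hsq
      exact hR (by rw [hsq]; ring)
    have gx : cRx x 1 - s * cqx x 1 b = 0 := by
      unfold fx at hx
      rw [hsq] at hx
      have h1 : (2 * s * cq x 1 b) * (cRx x 1 - s * cqx x 1 b) = 0 := by
        rw [hbs] at hx ⊢
        linear_combination hx
      exact (mul_eq_zero.mp h1).resolve_left
        (mul_ne_zero (mul_ne_zero two_ne_zero hs0) hq)
    have gb : cq x 1 b + 2 * b * cqb x 1 b = 0 := by
      unfold fb at hb
      have h1 : cq x 1 b * (cq x 1 b + 2 * b * cqb x 1 b) = 0 := by linear_combination -hb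
      exact (mul_eq_zero.mp h1).resolve_left hq
    subst hbs
    have e0 : (1 - s) * hH x s = 0 := by
      simp only [cR, cq, hH] at hsq ⊢
      linear_combination hsq
    have ex : (1 - s) * hHx x s = 0 := by
      simp only [cRx, cqx, hHx] at gx ⊢
      linear_combination gx
    have es : (1 - s) * hHs x s - hH x s = 0 := by
      simp only [cq, cqb, hHs, hH] at gb ⊢
      linear_combination -gb
    by_cases hs1 : s = 1
    · right
      subst hs1
      refine ⟨x, ?_, by norm_num⟩
      show 1 * x ^ 3 + (-10) * x ^ 2 + 4 * x + 0 = 0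
      simp only [hH] at es
      linear_combination (-1 / 7) * es
    · have h1s : 1 - s ≠ 0 := sub_ne_zero.mpr (Ne.symm hs1)
      have h0 := (mul_eq_zero.mp e0).resolve_left h1s
      have h1 := (mul_eq_zero.mp ex).resolve_left h1s
      have h2 : hHs x s = 0 := by
        rw [h0, sub_zero] at es
        exact (mul_eq_zero.mp es).resolve_left h1s
      left; right
      refine ⟨s, H_cub x s h0 h1 h2, ?_⟩
      rw [H_lin x s h0 h1 h2]

/-- Each point of `T` is singular, and a node. -/
lemma T_sing (x b : ℂ) (h : (x, b) ∈ T) : fx x 1 b = 0 ∧ fa x 1 b = 0 ∧ fb x 1 b = 0 ∧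
    fxx x 1 b * fbb x 1 b - fxb x 1 b ^ 2 ≠ 0 := by
  have case1 : x ∈ Z1 → cq x 1 b = 0 → b ≠ 0 → cqb x 1 b ≠ 0 →
      fx x 1 b = 0 ∧ fa x 1 b = 0 ∧ fb x 1 b = 0 ∧
      fxx x 1 b * fbb x 1 b - fxb x 1 b ^ 2 ≠ 0 := by
    intro hZ hq hb hqb
    have hR : cR x 1 = 0 := by
      have : 7 * x ^ 3 + (-28) * x ^ 2 + 28 * x + (-8) = 0 := hZ
      unfold cR
      linear_combination this
    have hRx : cRx x 1 ≠ 0 := by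
      intro hq
      simp only [cRx, cR] at hq hR
      apply one_ne_zero (α := ℂ)
      linear_combination ((41/8) + (-21/8)*x^1 )*hR + ( (3/2) + (-23/8)*x^1 + (7/8)*x^2 )*hq
    refine ⟨by simp [fx, hR, hq], by simp [fa, hR, hq], by simp [fb, hq], ?_⟩
    have : fxx x 1 b * fbb x 1 b - fxb x 1 b ^ 2 = -4 * b * cRx x 1 ^ 2 * cqb x 1 b ^ 2 := by
      simp only [fxx, fbb, fxb, hR, hq]
      ring
    rw [this]
    exact mul_ne_zero (mul_ne_zero (mul_ne_zero (by norm_num) hb) (pow_ne_zero _ hRx))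
      (pow_ne_zero _ hqb)
  have case2 : ∀ s, b = s ^ 2 → cR x 1 = s * cq x 1 b → cRx x 1 = s * cqx x 1 b →
      cq x 1 b + 2 * b * cqb x 1 b = 0 → fx x 1 b = 0 ∧ fa x 1 b = 0 ∧ fb x 1 b = 0 := by
    intro s hb hR hRx hqb
    have h1 : fx x 1 b = 0 := by
      unfold fx
      rw [hR, hRx, hb]
      ring
    have h2 : fb x 1 b = 0 := by
      unfold fb
      linear_combination -cq x 1 b * hqb
    refine ⟨h1, ?_, h2⟩
    have he := euler_f x 1 b
    rw [h1, h2, hR] at he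
    have h3 : (s * cq x 1 b) ^ 2 = b * cq x 1 b ^ 2 := by rw [hb]; ring
    linear_combination he + 7 * h3
  rcases h with (((⟨y, hp, hy⟩ | ⟨y, hp, hy⟩) | ⟨y, hp, hy⟩) | ⟨s, hp, hy⟩) | ⟨y, hp, hy⟩
  · simp only [Prod.mk.injEq] at hy
    obtain ⟨rfl, rfl⟩ := hy
    refine case1 hp ?_ one_ne_zero ?_
    · have hp' : 7 * y ^ 3 + (-28) * y ^ 2 + 28 * y + (-8) = 0 := hp
      unfold cq
      linear_combination hp'
    · intro hq
      have hp' : 7 * y ^ 3 + (-28) * y ^ 2 + 28 * y + (-8) = 0 := hp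
      unfold cqb at hq
      apply one_ne_zero (α := ℂ)
      linear_combination ((-315/328) + (-693/328)*y^1 )*hp'
        + ( (-137/82) + (819/328)*y^1 + (-231/328)*y^2 )*hq
  · simp only [Prod.mk.injEq] at hy
    obtain ⟨rfl, rfl⟩ := hy
    have hp' : 7 * y ^ 3 + (-28) * y ^ 2 + 28 * y + (-8) = 0 := hp
    refine case1 hp ?_ ?_ ?_
    · unfold cq b1
      linear_combination ((22) + (-119/2)*y^1 + (147/4)*y^2 + (-49/8)*y^3) * hp'
    · intro hq
      unfold b1 at hq
      apply one_ne_zero (α := ℂ)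
      linear_combination ((35/8) + (-21/16)*y^1 )*hp' + ( (9) + (-35/2)*y^1 + (21/4)*y^2 )*hq
    · intro hq
      unfold cqb b1 at hq
      apply one_ne_zero (α := ℂ)
      linear_combination
        ((-6405/104) + (14931/104)*y^1 + (-17003/208)*y^2 + (2793/208)*y^3 )*hp'
        + ( (34/13) + (-35/8)*y^1 + (133/104)*y^2 )*hq
  · simp only [Prod.mk.injEq] at hy
    obtain ⟨rfl, rfl⟩ := hy
    have hp' : 7 * y ^ 3 + (-28) * y ^ 2 + 28 * y + (-8) = 0 := hp
    refine case1 hp ?_ ?_ ?_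
    · unfold cq b2
      linear_combination ((-33/2) + (133/4)*y^1 + (-49/2)*y^2 + (49/8)*y^3) * hp'
    · intro hq
      unfold b2 at hq
      apply one_ne_zero (α := ℂ)
      linear_combination ((7) + (-21/4)*y^1 )*hp' + ( (-38) + (70)*y^1 + (-21)*y^2 )*hq
    · intro hq
      unfold cqb b2 at hq
      apply one_ne_zero (α := ℂ)
      linear_combination
        ((10381/533) + (-42889/1066)*y^1 + (14798/533)*y^2 + (-25725/4264)*y^3 )*hp'
        + ( (-1007/1066) + (77/41)*y^1 + (-1225/2132)*y^2 )*hq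
  · simp only [Prod.mk.injEq] at hy
    obtain ⟨rfl, rfl⟩ := hy
    have hp' : 1 * s ^ 3 + (-3) * s ^ 2 + (-4) * s + (-1) = 0 := hp
    obtain ⟨h1, h2, h3⟩ := case2 s rfl
      (by
        simp only [cR, cq]
        linear_combination ((8) + (24)*s^1 + (-8)*s^2 + (-32)*s^3 + (8)*s^4) * hp')
      (by
        simp only [cRx, cqx]
        linear_combination ((-28) + (28)*s^2) * hp')
      (by
        simp only [cq, cqb]
        linear_combination ((112)*s^2 + (-56)*s^3) * hp')
    refine ⟨h1, h2, h3, ?_⟩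
    have exx : fxx (-2 * s) 1 (s ^ 2) = (-523488) + (-2223424)*s^1 + (-2120160)*s^2 := by
      simp only [fxx, cR, cRx, cq, cqx]
      linear_combination ((-525952) + (-139776)*s^1 + (-39648)*s^2 + (-10752)*s^3 + (1792)*s^4
        + (15232)*s^5 + (6048)*s^6 + (-2240)*s^7) * hp'
    have exb : fxb (-2 * s) 1 (s ^ 2) = (-281568) + (-1195712)*s^1 + (-1139712)*s^2 := by
      simp only [fxb, cq, cqx, cqb]
      linear_combination ((-281568) + (-69440)*s^1 + (-17248)*s^2 + (-8960)*s^3 + (-27328)*s^4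
        + (-6496)*s^5 + (14336)*s^6 + (-2688)*s^7) * hp'
    have ebb : fbb (-2 * s) 1 (s ^ 2) = (-151872) + (-644448)*s^1 + (-613312)*s^2 := by
      simp only [fbb, cq, cqb]
      linear_combination ((-151872) + (-36960)*s^1 + (-2016)*s^2 + (23520)*s^3 + (-15232)*s^4
        + (-30464)*s^5 + (18816)*s^6 + (-2688)*s^7) * hp'
    rw [exx, exb, ebb]
    intro hq
    apply one_ne_zero (α := ℂ)
    linear_combination ((-3604726471/1183) + (-17229208007/1183)*s^1 + (-22866709090/1183)*s^2
      + (-1135028928/169)*s^3 )*hp'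
      + ( (-101553/7419776) + (-972303/59358208)*s^1 + (9053/1854944)*s^2 )*hq
  · simp only [Prod.mk.injEq] at hy
    obtain ⟨rfl, rfl⟩ := hy
    have hp' : 1 * y ^ 3 + (-10) * y ^ 2 + 4 * y + 0 = 0 := hp
    obtain ⟨h1, h2, h3⟩ := case2 1 (by ring)
      (by
        simp only [cR, cq]
        ring)
      (by
        simp only [cRx, cqx]
        ring)
      (by
        simp only [cq, cqb]
        linear_combination 7 * hp')
    refine ⟨h1, h2, h3, ?_⟩
    have exx : fxx y 1 1 = 0 := by
      simp only [fxx, cR, cRx, cq, cqx]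
      ring
    have exb : fxb y 1 1 = (224) + (10640)*y^1 + (-26880)*y^2 := by
      simp only [fxb, cq, cqx, cqb]
      linear_combination ((-3332) + (490)*y^1 + (-294)*y^2) * hp'
    rw [exx, exb]
    intro hq
    apply one_ne_zero (α := ℂ)
    linear_combination ((-33146725/282408) + (-911404675/94136)*y^1 + (-2461204500/11767)*y^2
      + (6623748000/11767)*y^3 )*hp'
      + ( (-1/50176) + (-26439535/3542525952)*y^1 + (919965/1180841984)*y^2 )*hq

section final
variable (p r : ℂ)

/-- The vector with coordinates `x`, `a = 1`, `b`. -/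
noncomputable def vec (t : ℂ × ℂ) : Fin 3 → ℂ := ![t.1, t.1 - 1, (t.2 - p * (t.1 - 1)) / r]

lemma vec_a (t : ℂ × ℂ) : vec p r t 0 - vec p r t 1 = 1 := by
  simp [vec]

lemma vec_b (hr : r ≠ 0) (t : ℂ × ℂ) : p * vec p r t 1 + r * vec p r t 2 = t.2 := by
  simp [vec]
  field_simp
  ring

lemma vec_ne (t : ℂ × ℂ) : vec p r t ≠ 0 := by
  intro h
  have := vec_a p r t
  rw [h] at this
  simp at this

/-- The corresponding point of the projective plane. -/
noncomputable def phi (t : ℂ × ℂ) : Projectivization ℂ (Fin 3 → ℂ) :=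
  Projectivization.mk ℂ (vec p r t) (vec_ne p r t)

lemma phi_inj (hr : r ≠ 0) : Function.Injective (phi p r) := by
  intro t u h
  unfold phi at h
  rw [Projectivization.mk_eq_mk_iff'] at h
  obtain ⟨c, hc⟩ := h
  have hi : ∀ i, c * vec p r u i = vec p r t i := fun i => by rw [← hc]; simp
  have hc1 : c = 1 := by
    have h1 := vec_a p r t
    have h2 := vec_a p r u
    rw [← hi, ← hi] at h1
    linear_combination h1 - c * h2
  subst hc1
  have h0 : u.1 = t.1 := by simpa [vec] using hi 0
  have h2 : u.2 = t.2 := by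
    rw [← vec_b p r hr t, ← vec_b p r hr u, ← hi 1, ← hi 2]
    ring
  exact Prod.ext h0.symm h2.symm

lemma eval_fs (v : Fin 3 → ℂ) :
    eval v (fx (X 0) Ap (Bp p r)) = fx (v 0) (v 0 - v 1) (p * v 1 + r * v 2) ∧
    eval v (fa (X 0) Ap (Bp p r)) = fa (v 0) (v 0 - v 1) (p * v 1 + r * v 2) ∧
    eval v (fb (X 0) Ap (Bp p r)) = fb (v 0) (v 0 - v 1) (p * v 1 + r * v 2) := by
  refine ⟨?_, ?_, ?_⟩ <;>
    simp only [fx, fa, fb, cR, cRx, cRa, cq, cqx, cqa, cqb, Ap, Bp, map_sub, map_add, map_mul,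
      map_pow, map_neg, map_ofNat, eval_X, eval_C]

lemma jac_iff (hr : r ≠ 0) (v : Fin 3 → ℂ) : VanishingJacobianAt (Fpoly p r) v ↔
    fx (v 0) (v 0 - v 1) (p * v 1 + r * v 2) = 0 ∧
    fa (v 0) (v 0 - v 1) (p * v 1 + r * v 2) = 0 ∧
    fb (v 0) (v 0 - v 1) (p * v 1 + r * v 2) = 0 := by
  obtain ⟨h1, h2, h3⟩ := eval_fs p r v
  unfold VanishingJacobianAt
  rw [Fin.forall_fin_succ, Fin.forall_fin_two]
  change eval v (pderiv 0 (Fpoly p r)) = 0 ∧ eval v (pderiv 1 (Fpoly p r)) = 0 ∧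
    eval v (pderiv 2 (Fpoly p r)) = 0 ↔ _
  rw [dF0, dF1, dF2]
  simp only [map_add, map_neg, map_mul, eval_C, h1, h2, h3]
  constructor
  · rintro ⟨e0, e1, e2⟩
    have hb := (mul_eq_zero.mp e2).resolve_left hr
    rw [hb] at e1 ⊢
    have ha : fa (v 0) (v 0 - v 1) (p * v 1 + r * v 2) = 0 := by linear_combination -e1
    rw [ha] at e0 ⊢
    exact ⟨by linear_combination e0, rfl, rfl⟩
  · rintro ⟨e0, e1, e2⟩
    rw [e0, e1, e2]
    simp

lemma a_ne_zero (x a b : ℂ) (hx : fx x a b = 0) (ha : fa x a b = 0) (hb : fb x a b = 0)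
    (h0 : ¬ (x = 0 ∧ a = 0 ∧ b = 0)) : a ≠ 0 := by
  rintro rfl
  have he := euler_f x 0 b
  rw [hx, ha, hb] at he
  have h1 : b * cq x 0 b ^ 2 = 0 := by linear_combination (1 / 7) * he
  have hx6 : b * cq x 0 b = 0 → x = 0 := by
    intro h2
    unfold fa at ha
    have h3 : cR x 0 ^ 2 = 0 := by linear_combination ha + 2 * cqa x 0 b * h2
    have h4 : 7 * x ^ 3 = 0 := by
      have : cR x 0 = 0 := by simpa using h3
      unfold cR at this
      linear_combination this
    simpa using h4
  rcases mul_eq_zero.mp h1 with h2 | h2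
  · exact h0 ⟨hx6 (by rw [h2]; ring), rfl, h2⟩
  · have hq : cq x 0 b = 0 := by simpa using h2
    have hx0 := hx6 (by rw [hq]; ring)
    rw [hx0] at hq
    have : b ^ 3 = 0 := by
      unfold cq at hq
      linear_combination (-1 / 8) * hq
    exact h0 ⟨hx0, rfl, by simpa using this⟩

lemma sing_iff (hr : r ≠ 0) (q : Projectivization ℂ (Fin 3 → ℂ)) :
    IsSingularPoint (Fpoly p r) q ↔ q ∈ phi p r '' T := by
  constructor
  · rintro ⟨v, hv, rfl, hJ⟩
    rw [jac_iff p r hr] at hJ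
    obtain ⟨x, hx⟩ : ∃ x, x = v 0 := ⟨_, rfl⟩
    obtain ⟨a, ha⟩ : ∃ a, a = v 0 - v 1 := ⟨_, rfl⟩
    obtain ⟨b, hb⟩ : ∃ b, b = p * v 1 + r * v 2 := ⟨_, rfl⟩
    rw [← ha, ← hb, ← hx] at hJ
    obtain ⟨h1, h2, h3⟩ := hJ
    have ha0 : a ≠ 0 := by
      apply a_ne_zero x a b h1 h2 h3
      rintro ⟨e1, e2, e3⟩
      apply hv
      have v0 : v 0 = 0 := by rw [← hx, e1]
      have v1 : v 1 = 0 := by linear_combination v0 + ha - e2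
      have v2 : v 2 = 0 := by
        have : r * v 2 = 0 := by linear_combination e3 - hb - p * v1
        exact (mul_eq_zero.mp this).resolve_left hr
      funext i
      fin_cases i
      · exact v0
      · exact v1
      · exact v2
    obtain ⟨x', hx'⟩ : ∃ x', x = a * x' := ⟨x / a, by field_simp⟩
    obtain ⟨b', hb'⟩ : ∃ b', b = a * b' := ⟨b / a, by field_simp⟩
    have ha6 : a ^ 6 ≠ 0 := pow_ne_zero _ ha0
    refine ⟨(x', b'), classify x' b' ?_ ?_ ?_, ?_⟩
    · have : a ^ 6 * fx x' 1 b' = fx x a b := by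
        rw [hx', hb']
        simp only [fx, cR, cRx, cq, cqx]
        ring
      rw [h1] at this
      exact (mul_eq_zero.mp this).resolve_left ha6
    · have : a ^ 6 * fa x' 1 b' = fa x a b := by
        rw [hx', hb']
        simp only [fa, cR, cRa, cq, cqa]
        ring
      rw [h2] at this
      exact (mul_eq_zero.mp this).resolve_left ha6
    · have : a ^ 6 * fb x' 1 b' = fb x a b := by
        rw [hx', hb']
        simp only [fb, cq, cqb]
        ring
      rw [h3] at this
      exact (mul_eq_zero.mp this).resolve_left ha6
    · unfold phi
      rw [eq_comm, Projectivization.mk_eq_mk_iff']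
      refine ⟨a, ?_⟩
      have e0 : a * vec p r (x', b') 0 = v 0 := by
        rw [← hx, hx']; simp [vec]
      have e1 : a * vec p r (x', b') 1 = v 1 := by
        have := vec_a p r (x', b')
        linear_combination e0 - a * this - ha
      have e2 : a * vec p r (x', b') 2 = v 2 := by
        have h4 := vec_b p r hr (x', b')
        simp only at h4
        have h5 : r * (a * vec p r (x', b') 2 - v 2) = 0 := by
          linear_combination a * h4 - p * e1 - hb' + hb
        exact sub_eq_zero.mp ((mul_eq_zero.mp h5).resolve_left hr)
      funext i
      fin_cases i
      · exact e0
      · exact e1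
      · exact e2
  · rintro ⟨⟨x, b⟩, ht, rfl⟩
    refine ⟨vec p r (x, b), vec_ne p r _, rfl, ?_⟩
    rw [jac_iff p r hr, vec_a, vec_b p r hr]
    obtain ⟨h1, h2, h3, -⟩ := T_sing x b ht
    exact ⟨h1, h2, h3⟩

lemma sing_node (hr : r ≠ 0) (q : Projectivization ℂ (Fin 3 → ℂ))
    (hq : IsSingularPoint (Fpoly p r) q) : IsNode (Fpoly p r) q := by
  rw [sing_iff p r hr] at hq
  obtain ⟨⟨x, b⟩, ht, rfl⟩ := hq
  obtain ⟨h1, h2, h3, h4⟩ := T_sing x b ht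
  have hJ : VanishingJacobianAt (Fpoly p r) (vec p r (x, b)) := by
    rw [jac_iff p r hr, vec_a, vec_b p r hr]
    exact ⟨h1, h2, h3⟩
  exact ⟨vec p r (x, b), vec_ne p r _, rfl, hJ,
    hess_rank p r _ (vec_ne p r _) hr hJ x 1 b rfl (vec_a p r _) (vec_b p r hr _) h4⟩

lemma axis_iff (t : ℂ × ℂ) : LiesOnAxisX0 (phi p r t) ↔ t.1 = 0 := by
  constructor
  · rintro ⟨v, hv, h, h0⟩
    unfold phi at h
    rw [eq_comm, Projectivization.mk_eq_mk_iff'] at h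
    obtain ⟨c, hc⟩ := h
    have := congrFun hc 0
    simp only [Pi.smul_apply, h0, smul_zero] at this
    simpa [vec] using this.symm
  · intro h
    exact ⟨vec p r t, vec_ne p r t, rfl, by simpa [vec] using h⟩

lemma T_axis (x b : ℂ) (ht : (x, b) ∈ T) (h0 : x = 0) : b = 1 := by
  subst h0
  rcases ht with (((⟨y, hp, hy⟩ | ⟨y, hp, hy⟩) | ⟨y, hp, hy⟩) | ⟨s, hp, hy⟩) | ⟨y, hp, hy⟩
  · simp only [Prod.mk.injEq] at hy
    exact hy.2.symm
  · simp only [Prod.mk.injEq] at hy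
    rw [hy.1] at hp
    norm_num [Z1] at hp
  · simp only [Prod.mk.injEq] at hy
    rw [hy.1] at hp
    norm_num [Z1] at hp
  · simp only [Prod.mk.injEq] at hy
    have hs : s = 0 := by linear_combination (-1 / 2) * hy.1
    rw [hs] at hp
    norm_num [Z4] at hp
  · simp only [Prod.mk.injEq] at hy
    exact hy.2.symm

lemma main (hr : r ≠ 0) :
    {q : Projectivization ℂ (Fin 3 → ℂ) | IsSingularPoint (Fpoly p r) q}.ncard = 15 ∧
      (∀ q : Projectivization ℂ (Fin 3 → ℂ), IsSingularPoint (Fpoly p r) q →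
        IsNode (Fpoly p r) q) ∧
      {q : Projectivization ℂ (Fin 3 → ℂ) |
          IsSingularPoint (Fpoly p r) q ∧ LiesOnAxisX0 q}.ncard = 1 := by
  refine ⟨?_, fun q hq => sing_node p r hr q hq, ?_⟩
  · have : {q : Projectivization ℂ (Fin 3 → ℂ) | IsSingularPoint (Fpoly p r) q}
        = phi p r '' T := by
      ext q
      exact sing_iff p r hr q
    rw [this, Set.ncard_image_of_injective _ (phi_inj p r hr), T_ncard]
  · rw [Set.ncard_eq_one]
    refine ⟨phi p r (0, 1), ?_⟩
    ext q
    simp only [Set.mem_setOf_eq, Set.mem_singleton_iff]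
    rw [sing_iff p r hr]
    constructor
    · rintro ⟨⟨⟨x, b⟩, ht, rfl⟩, hax⟩
      rw [axis_iff] at hax
      have hx : x = 0 := hax
      rw [T_axis x b ht hx, hx]
    · rintro rfl
      refine ⟨⟨(0, 1), ?_, rfl⟩, by rw [axis_iff]⟩
      right
      exact ⟨0, by simp [Z5], rfl⟩

end final

end Septic

/-- For α with 7α³ + 7α + 1 = 0 and the parameters of the theorem,
the plane septic curve {S_α(x, 0, z, w) = 0} ⊂ ℙ²(ℂ) has exactly 15 singular
points, all nodes, exactly one of which satisfies x = 0. -/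
theorem plane_septic_15_nodes (α : ℂ) (hα : 7 * α ^ 3 + 7 * α + 1 = 0)
    (a₁ a₂ a₃ a₄ a₅ : ℂ)
    (ha₁ : a₁ = -(12 / 7) * α ^ 2 - (384 / 49) * α - 8 / 7)
    (ha₂ : a₂ = -(32 / 7) * α ^ 2 + (24 / 49) * α - 4)
    (ha₃ : a₃ = -4 * α ^ 2 + (24 / 49) * α - 4)
    (ha₄ : a₄ = -(8 / 7) * α ^ 2 + (8 / 49) * α - 8 / 7)
    (ha₅ : a₅ = 49 * α ^ 2 - 7 * α + 50)
    (S : MvPolynomial (Fin 4) ℂ) (hS : S = Psept - Usept a₁ a₂ a₃ a₄ a₅)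
    (Sy : MvPolynomial (Fin 3) ℂ)
    (hSy : Sy = aeval (![X 0, 0, X 1, X 2] : Fin 4 → MvPolynomial (Fin 3) ℂ) S) :
    {q : Projectivization ℂ (Fin 3 → ℂ) | IsSingularPoint Sy q}.ncard = 15 ∧
      (∀ q : Projectivization ℂ (Fin 3 → ℂ), IsSingularPoint Sy q → IsNode Sy q) ∧
      {q : Projectivization ℂ (Fin 3 → ℂ) |
          IsSingularPoint Sy q ∧ LiesOnAxisX0 q}.ncard = 1 := by
  subst ha₁ ha₂ ha₃ ha₄ ha₅ hS
  rw [Septic.Sy_eq α hα] at hSy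
  subst hSy
  apply Septic.main
  intro h
  apply one_ne_zero (α := ℂ)
  linear_combination hα - 7 * α * h
end

section
/- Let α ∈ ℂ satisfy 7α³ + 7α + 1 = 0 and let S_α := P − U_{a₁,…,a₅} with a₁ := −(12/7)α² − (384/49)α − 8/7, a₂ := −(32/7)α² + (24/49)α − 4, a₃ := −4α² + (24/49)α − 4, a₄ := −(8/7)α² + (8/49)α − 8/7, a₅ := 49α² − 7α + 50. Let S_{y,6} ∈ ℂ[x,z,w] be the homogeneous sextic defined by the splitting S_α(x, 0, z, w) = (z − x/(1+α²) + w) · S_{y,6}(x,z,w). Then the plane sextic curve {S_{y,6} = 0} in ℙ²(ℂ) has exactly 9 singular points, and every one of them is a node. -/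
open MvPolynomial

set_option linter.unusedSimpArgs false
set_option linter.unusedVariables false
def sF {R : Type*} [CommRing R] (x z m : R) : R :=
  x^6 + 7*x^5*z - x^5*m - 7*x^4*z*m + x^4*m^2 - 56*x^3*z^3 + 56*x^3*z*m^2 + 48*x^3*m^3 + 56*x^2*z^3*m - 56*x^2*z*m^3 - 48*x^2*m^4 + 112*x*z^5 - 112*x*z^4*m - 112*x*z^3*m^2 + 112*x*z^2*m^3 - 64*x*m^5 - 112*z^5*m + 112*z^4*m^2 + 112*z^3*m^3 - 112*z^2*m^4 + 64*m^6

def gX {R : Type*} [CommRing R] (x z m : R) : R :=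
  6*x^5 + 35*x^4*z - 5*x^4*m - 28*x^3*z*m + 4*x^3*m^2 - 168*x^2*z^3 + 168*x^2*z*m^2 + 144*x^2*m^3 + 112*x*z^3*m - 112*x*z*m^3 - 96*x*m^4 + 112*z^5 - 112*z^4*m - 112*z^3*m^2 + 112*z^2*m^3 - 64*m^5

def gZ {R : Type*} [CommRing R] (x z m : R) : R :=
  7*x^5 - 7*x^4*m - 168*x^3*z^2 + 56*x^3*m^2 + 168*x^2*z^2*m - 56*x^2*m^3 + 560*x*z^4 - 448*x*z^3*m - 336*x*z^2*m^2 + 224*x*z*m^3 - 560*z^4*m + 448*z^3*m^2 + 336*z^2*m^3 - 224*z*m^4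

def gM {R : Type*} [CommRing R] (x z m : R) : R :=
  - x^5 - 7*x^4*z + 2*x^4*m + 112*x^3*z*m + 144*x^3*m^2 + 56*x^2*z^3 - 168*x^2*z*m^2 - 192*x^2*m^3 - 112*x*z^4 - 224*x*z^3*m + 336*x*z^2*m^2 - 320*x*m^4 - 112*z^5 + 224*z^4*m + 336*z^3*m^2 - 448*z^2*m^3 + 384*m^5

def hXX {R : Type*} [CommRing R] (x z m : R) : R :=
  30*x^4 + 140*x^3*z - 20*x^3*m - 84*x^2*z*m + 12*x^2*m^2 - 336*x*z^3 + 336*x*z*m^2 + 288*x*m^3 + 112*z^3*m - 112*z*m^3 - 96*m^4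

def hXZ {R : Type*} [CommRing R] (x z m : R) : R :=
  35*x^4 - 28*x^3*m - 504*x^2*z^2 + 168*x^2*m^2 + 336*x*z^2*m - 112*x*m^3 + 560*z^4 - 448*z^3*m - 336*z^2*m^2 + 224*z*m^3

def hXM {R : Type*} [CommRing R] (x z m : R) : R :=
  - 5*x^4 - 28*x^3*z + 8*x^3*m + 336*x^2*z*m + 432*x^2*m^2 + 112*x*z^3 - 336*x*z*m^2 - 384*x*m^3 - 112*z^4 - 224*z^3*m + 336*z^2*m^2 - 320*m^4

def hZZ {R : Type*} [CommRing R] (x z m : R) : R :=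
  - 336*x^3*z + 336*x^2*z*m + 2240*x*z^3 - 1344*x*z^2*m - 672*x*z*m^2 + 224*x*m^3 - 2240*z^3*m + 1344*z^2*m^2 + 672*z*m^3 - 224*m^4

def hZM {R : Type*} [CommRing R] (x z m : R) : R :=
  - 7*x^4 + 112*x^3*m + 168*x^2*z^2 - 168*x^2*m^2 - 448*x*z^3 - 672*x*z^2*m + 672*x*z*m^2 - 560*z^4 + 896*z^3*m + 1008*z^2*m^2 - 896*z*m^3

def hMM {R : Type*} [CommRing R] (x z m : R) : R :=
  2*x^4 + 112*x^3*z + 288*x^3*m - 336*x^2*z*m - 576*x^2*m^2 - 224*x*z^3 + 672*x*z^2*m - 1280*x*m^3 + 224*z^4 + 672*z^3*m - 1344*z^2*m^2 + 1920*m^4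

def cC {R : Type*} [CommRing R] (x z m : R) : R :=
  x^3 + 4*x^2*z - 4*x*z^2 - 8*z^3

def cE {R : Type*} [CommRing R] (x z m : R) : R :=
  x^3 - 2*x^2*z - 8*x*z^2 + 8*z^3

def cq {R : Type*} [CommRing R] (x z m : R) : R :=
  x^2 + 4*x*z - 8*x*m - 4*z^2 - 4*z*m + 8*m^2

def ch {R : Type*} [CommRing R] (x z m : R) : R :=
  x^2 - 4*z^2 + 4*z*m


section deriv
variable (D : Derivation ℂ (MvPolynomial (Fin 3) ℂ) (MvPolynomial (Fin 3) ℂ))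
  (a b c : MvPolynomial (Fin 3) ℂ)


theorem D_sF : D (sF a b c) =
    gX a b c * D a + gZ a b c * D b + gM a b c * D c := by
  have n7 : D ((7 : MvPolynomial (Fin 3) ℂ)) = 0 := by exact_mod_cast D.map_natCast 7
  have n48 : D ((48 : MvPolynomial (Fin 3) ℂ)) = 0 := by exact_mod_cast D.map_natCast 48
  have n56 : D ((56 : MvPolynomial (Fin 3) ℂ)) = 0 := by exact_mod_cast D.map_natCast 56
  have n64 : D ((64 : MvPolynomial (Fin 3) ℂ)) = 0 := by exact_mod_cast D.map_natCast 64
  have n112 : D ((112 : MvPolynomial (Fin 3) ℂ)) = 0 := by exact_mod_cast D.map_natCast 112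
  simp only [sF, gX, gZ, gM, map_add, map_sub, map_neg, Derivation.leibniz, Derivation.leibniz_pow,
    n7, n48, n56, n64, n112, smul_eq_mul, nsmul_eq_mul]
  push_cast
  ring

theorem D_gX : D (gX a b c) =
    hXX a b c * D a + hXZ a b c * D b + hXM a b c * D c := by
  have n4 : D ((4 : MvPolynomial (Fin 3) ℂ)) = 0 := by exact_mod_cast D.map_natCast 4
  have n5 : D ((5 : MvPolynomial (Fin 3) ℂ)) = 0 := by exact_mod_cast D.map_natCast 5
  have n6 : D ((6 : MvPolynomial (Fin 3) ℂ)) = 0 := by exact_mod_cast D.map_natCast 6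
  have n28 : D ((28 : MvPolynomial (Fin 3) ℂ)) = 0 := by exact_mod_cast D.map_natCast 28
  have n35 : D ((35 : MvPolynomial (Fin 3) ℂ)) = 0 := by exact_mod_cast D.map_natCast 35
  have n64 : D ((64 : MvPolynomial (Fin 3) ℂ)) = 0 := by exact_mod_cast D.map_natCast 64
  have n96 : D ((96 : MvPolynomial (Fin 3) ℂ)) = 0 := by exact_mod_cast D.map_natCast 96
  have n112 : D ((112 : MvPolynomial (Fin 3) ℂ)) = 0 := by exact_mod_cast D.map_natCast 112
  have n144 : D ((144 : MvPolynomial (Fin 3) ℂ)) = 0 := by exact_mod_cast D.map_natCast 144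
  have n168 : D ((168 : MvPolynomial (Fin 3) ℂ)) = 0 := by exact_mod_cast D.map_natCast 168
  simp only [gX, hXX, hXZ, hXM, map_add, map_sub, map_neg, Derivation.leibniz, Derivation.leibniz_pow,
    n4, n5, n6, n28, n35, n64, n96, n112, n144, n168, smul_eq_mul, nsmul_eq_mul]
  push_cast
  ring

theorem D_gZ : D (gZ a b c) =
    hXZ a b c * D a + hZZ a b c * D b + hZM a b c * D c := by
  have n7 : D ((7 : MvPolynomial (Fin 3) ℂ)) = 0 := by exact_mod_cast D.map_natCast 7
  have n56 : D ((56 : MvPolynomial (Fin 3) ℂ)) = 0 := by exact_mod_cast D.map_natCast 56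
  have n168 : D ((168 : MvPolynomial (Fin 3) ℂ)) = 0 := by exact_mod_cast D.map_natCast 168
  have n224 : D ((224 : MvPolynomial (Fin 3) ℂ)) = 0 := by exact_mod_cast D.map_natCast 224
  have n336 : D ((336 : MvPolynomial (Fin 3) ℂ)) = 0 := by exact_mod_cast D.map_natCast 336
  have n448 : D ((448 : MvPolynomial (Fin 3) ℂ)) = 0 := by exact_mod_cast D.map_natCast 448
  have n560 : D ((560 : MvPolynomial (Fin 3) ℂ)) = 0 := by exact_mod_cast D.map_natCast 560
  simp only [gZ, hXZ, hZZ, hZM, map_add, map_sub, map_neg, Derivation.leibniz, Derivation.leibniz_pow,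
    n7, n56, n168, n224, n336, n448, n560, smul_eq_mul, nsmul_eq_mul]
  push_cast
  ring

theorem D_gM : D (gM a b c) =
    hXM a b c * D a + hZM a b c * D b + hMM a b c * D c := by
  have n2 : D ((2 : MvPolynomial (Fin 3) ℂ)) = 0 := by exact_mod_cast D.map_natCast 2
  have n7 : D ((7 : MvPolynomial (Fin 3) ℂ)) = 0 := by exact_mod_cast D.map_natCast 7
  have n56 : D ((56 : MvPolynomial (Fin 3) ℂ)) = 0 := by exact_mod_cast D.map_natCast 56
  have n112 : D ((112 : MvPolynomial (Fin 3) ℂ)) = 0 := by exact_mod_cast D.map_natCast 112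
  have n144 : D ((144 : MvPolynomial (Fin 3) ℂ)) = 0 := by exact_mod_cast D.map_natCast 144
  have n168 : D ((168 : MvPolynomial (Fin 3) ℂ)) = 0 := by exact_mod_cast D.map_natCast 168
  have n192 : D ((192 : MvPolynomial (Fin 3) ℂ)) = 0 := by exact_mod_cast D.map_natCast 192
  have n224 : D ((224 : MvPolynomial (Fin 3) ℂ)) = 0 := by exact_mod_cast D.map_natCast 224
  have n320 : D ((320 : MvPolynomial (Fin 3) ℂ)) = 0 := by exact_mod_cast D.map_natCast 320
  have n336 : D ((336 : MvPolynomial (Fin 3) ℂ)) = 0 := by exact_mod_cast D.map_natCast 336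
  have n384 : D ((384 : MvPolynomial (Fin 3) ℂ)) = 0 := by exact_mod_cast D.map_natCast 384
  have n448 : D ((448 : MvPolynomial (Fin 3) ℂ)) = 0 := by exact_mod_cast D.map_natCast 448
  simp only [gM, hXM, hZM, hMM, map_add, map_sub, map_neg, Derivation.leibniz, Derivation.leibniz_pow,
    n2, n7, n56, n112, n144, n168, n192, n224, n320, n336, n384, n448, smul_eq_mul, nsmul_eq_mul]
  push_cast
  ring

end deriv

theorem eval_sF (v : Fin 3 → ℂ) (a b c : MvPolynomial (Fin 3) ℂ) :
    eval v (sF a b c) = sF (eval v a) (eval v b) (eval v c) := by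
  simp [sF]

theorem eval_gX (v : Fin 3 → ℂ) (a b c : MvPolynomial (Fin 3) ℂ) :
    eval v (gX a b c) = gX (eval v a) (eval v b) (eval v c) := by
  simp [gX]

theorem eval_gZ (v : Fin 3 → ℂ) (a b c : MvPolynomial (Fin 3) ℂ) :
    eval v (gZ a b c) = gZ (eval v a) (eval v b) (eval v c) := by
  simp [gZ]

theorem eval_gM (v : Fin 3 → ℂ) (a b c : MvPolynomial (Fin 3) ℂ) :
    eval v (gM a b c) = gM (eval v a) (eval v b) (eval v c) := by
  simp [gM]

theorem eval_hXX (v : Fin 3 → ℂ) (a b c : MvPolynomial (Fin 3) ℂ) :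
    eval v (hXX a b c) = hXX (eval v a) (eval v b) (eval v c) := by
  simp [hXX]

theorem eval_hXZ (v : Fin 3 → ℂ) (a b c : MvPolynomial (Fin 3) ℂ) :
    eval v (hXZ a b c) = hXZ (eval v a) (eval v b) (eval v c) := by
  simp [hXZ]

theorem eval_hXM (v : Fin 3 → ℂ) (a b c : MvPolynomial (Fin 3) ℂ) :
    eval v (hXM a b c) = hXM (eval v a) (eval v b) (eval v c) := by
  simp [hXM]

theorem eval_hZZ (v : Fin 3 → ℂ) (a b c : MvPolynomial (Fin 3) ℂ) :
    eval v (hZZ a b c) = hZZ (eval v a) (eval v b) (eval v c) := by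
  simp [hZZ]

theorem eval_hZM (v : Fin 3 → ℂ) (a b c : MvPolynomial (Fin 3) ℂ) :
    eval v (hZM a b c) = hZM (eval v a) (eval v b) (eval v c) := by
  simp [hZM]

theorem eval_hMM (v : Fin 3 → ℂ) (a b c : MvPolynomial (Fin 3) ℂ) :
    eval v (hMM a b c) = hMM (eval v a) (eval v b) (eval v c) := by
  simp [hMM]

theorem euler_gX (x z m : ℂ) : hXX x z m * x + hXZ x z m * z + hXM x z m * m = 5 * gX x z m := by
  simp only [gX, hXX, hXZ, hXM]; ring

theorem euler_gZ (x z m : ℂ) : hXZ x z m * x + hZZ x z m * z + hZM x z m * m = 5 * gZ x z m := by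
  simp only [gZ, hXZ, hZZ, hZM]; ring

theorem euler_gM (x z m : ℂ) : hXM x z m * x + hZM x z m * z + hMM x z m * m = 5 * gM x z m := by
  simp only [gM, hXM, hZM, hMM]; ring

set_option maxHeartbeats 4000000 in
theorem cert1 (x z m : ℂ) (hx : gX x z m = 0) (hz : gZ x z m = 0) (hm : gM x z m = 0) :
    cC x z m * cE x z m * z ^ 4 = 0 := by
  simp only [gX, gZ, gM] at hx hz hm
  simp only [cC, cE, cq, ch]
  linear_combination (- (66583/157248)*x^5 + (118051/52416)*x^4*z + (1425461/393120)*x^4*m - (38762/12285)*x^3*z^2 - (379993/24570)*x^3*z*m - (722597/393120)*x^3*m^2 - (425239/98280)*x^2*z^3 + (955/56)*x^2*z^2*m + (170371/10920)*x^2*z*m^2 - (20906/1365)*x^2*m^3 + (166211/9828)*x*z^4 + (419474/12285)*x*z^3*m - (1544429/98280)*x*z^2*m^2 + (7505/19656)*x*z*m^3 + (3291/260)*x*m^4 - (447011/49140)*z^5 - (56588/1755)*z^4*m - (11809/468)*z^3*m^2 + (57641/3510)*z^2*m^3) * hx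
    + ((33901/112320)*x^5 - (373253/786240)*x^4*z - (2145341/786240)*x^4*m - (422/189)*x^3*z^2 + (422309/112320)*x^3*z*m + (107987/16380)*x^3*m^2 + (309157/39312)*x^2*z^3 + (242666/12285)*x^2*z^2*m + (882149/196560)*x^2*z*m^2 + (87881/32760)*x^2*m^3 - (173881/98280)*x*z^4 - (3900823/196560)*x*z^3*m - (759427/65520)*x*z^2*m^2 + (125239/32760)*x*z*m^3 - (70849/12285)*x*m^4 - (395063/49140)*z^5 - (409103/49140)*z^4*m + (407699/49140)*z^3*m^2 + (6/35)*z^2*m^3 - (57641/12285)*z*m^4) * hz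
    + (- (336341/786240)*x^5 - (1285819/786240)*x^4*z + (472963/262080)*x^4*m + (328057/65520)*x^3*z^2 + (105817/196560)*x^3*z*m - (1754183/262080)*x^3*m^2 + (6641/630)*x^2*z^3 - (8369/49140)*x^2*z^2*m + (59587/7560)*x^2*z*m^2 + (15527/6552)*x^2*m^3 - (739369/49140)*x*z^4 - (20119/3640)*x*z^3*m + (672827/65520)*x*z^2*m^2 - (648749/196560)*x*z*m^3 + (1097/520)*x*m^4 - (418931/49140)*z^5) * hm

set_option maxHeartbeats 4000000 in
theorem cert2 (x z m : ℂ) (hx : gX x z m = 0) (hz : gZ x z m = 0) (hm : gM x z m = 0) :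
    cE x z m * cq x z m * z ^ 5 = 0 := by
  simp only [gX, gZ, gM] at hx hz hm
  simp only [cC, cE, cq, ch]
  linear_combination (- (865/3276)*x^5 + (1301/1248)*x^4*z + (196691/131040)*x^4*m + (1307/4680)*x^3*z^2 - (423359/65520)*x^3*z*m - (4409/4680)*x^3*m^2 - (87349/32760)*x^2*z^3 + (471/56)*x^2*z^2*m + (69203/10920)*x^2*z*m^2 - (37337/5460)*x^2*m^3 + (473/117)*x*z^4 + (252311/16380)*x*z^3*m - (137497/16380)*x*z^2*m^2 - (608/819)*x*z*m^3 + (2819/455)*x*m^4 - (13724/4095)*z^5 - (14431/1170)*z^4*m - (665/78)*z^3*m^2 + (3403/585)*z^2*m^3) * hx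
    + ((50587/262080)*x^5 + (25147/262080)*x^4*z - (71849/65520)*x^4*m - (263/252)*x^3*z^2 + (84781/32760)*x^3*z*m + (4778/1365)*x^3*m^2 + (32797/13104)*x^2*z^3 + (68993/9360)*x^2*z^2*m + (22657/32760)*x^2*z*m^2 + (3089/2730)*x^2*m^3 - (17243/16380)*x*z^4 - (149857/16380)*x*z^3*m - (2283/910)*x*z^2*m^2 + (1487/910)*x*z*m^3 - (14359/4095)*x*m^4 - (24289/8190)*z^5 - (11852/4095)*z^4*m + (24757/8190)*z^3*m^2 - (2/35)*z^2*m^3 - (6806/4095)*z*m^4) * hz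
    + (- (61091/262080)*x^5 - (12791/18720)*x^4*z + (72743/87360)*x^4*m + (10021/3120)*x^3*z^2 + (5767/65520)*x^3*z*m - (813/260)*x^3*m^2 + (3359/840)*x^2*z^3 - (94061/65520)*x^2*z^2*m + (16799/5040)*x^2*z*m^2 + (2773/2184)*x^2*m^3 - (9701/1170)*x*z^4 + (1361/2730)*x*z^3*m + (24263/5460)*x*z^2*m^2 - (35531/16380)*x*z*m^3 + (2819/2730)*x*m^4 - (12554/4095)*z^5) * hm

set_option maxHeartbeats 4000000 in
theorem cert3 (x z m : ℂ) (hx : gX x z m = 0) (hz : gZ x z m = 0) (hm : gM x z m = 0) :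
    cC x z m * ch x z m * z ^ 5 = 0 := by
  simp only [gX, gZ, gM] at hx hz hm
  simp only [cC, cE, cq, ch]
  linear_combination ((103949/628992)*x^5 - (188375/209664)*x^4*z - (284387/196560)*x^4*m + (482471/393120)*x^3*z^2 + (4834939/786240)*x^3*z*m + (1326397/1572480)*x^3*m^2 + (106217/56160)*x^2*z^3 - (2089/336)*x^2*z^2*m - (16661/2730)*x^2*z*m^2 + (6049/1040)*x^2*m^3 - (238951/39312)*x*z^4 - (2645821/196560)*x*z^3*m + (2024359/393120)*x*z^2*m^2 - (26965/78624)*x*z*m^3 - (35117/7280)*x*m^4 + (685891/196560)*z^5 + (86953/7020)*z^4*m + (18233/1872)*z^3*m^2 - (89761/14040)*z^2*m^3) * hx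
    + (- (93293/786240)*x^5 + (302699/1572480)*x^4*z + (3440761/3144960)*x^4*m + (22595/24192)*x^3*z^2 - (4081423/3144960)*x^3*z*m - (333899/131040)*x^3*m^2 - (14359/4914)*x^2*z^3 - (5959231/786240)*x^2*z^2*m - (1665319/786240)*x^2*z*m^2 - (175621/131040)*x^2*m^3 + (21409/28080)*x*z^4 + (6040973/786240)*x*z^3*m + (1098407/262080)*x*z^2*m^2 - (195599/131040)*x*z*m^3 + (120779/49140)*x*m^4 + (612883/196560)*z^5 + (626923/196560)*z^4*m - (88357/28080)*z^3*m^2 - (3/70)*z^2*m^3 + (12823/7020)*z*m^4) * hz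
    + ((253133/1572480)*x^5 + (1931249/3144960)*x^4*z - (364969/524160)*x^4*m - (250111/131040)*x^3*z^2 - (278839/1572480)*x^3*z*m + (2730463/1048320)*x^3*m^2 - (5587/1440)*x^2*z^3 - (142619/786240)*x^2*z^2*m - (200299/60480)*x^2*z*m^2 - (1697/1872)*x^2*m^3 + (1211849/196560)*x*z^4 + (13367/7280)*x*z^3*m - (1142137/262080)*x*z^2*m^2 + (1082329/786240)*x*z*m^3 - (35117/43680)*x*m^4 + (629731/196560)*z^5) * hm

set_option maxHeartbeats 4000000 in
theorem cert4 (x z m : ℂ) (hx : gX x z m = 0) (hz : gZ x z m = 0) (hm : gM x z m = 0) (h0 : z = 0) :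
    x ^ 7 = 0 := by
  simp only [gX, gZ, gM] at hx hz hm

  linear_combination (- (2/21)*x^2 + (3/7)*x*z - (1/7)*x*m + (6/7)*z*m) * hx
    + ((3/14)*x^2 - (1/42)*x*z + (2/7)*x*m + (1/7)*z^2) * hz
    + (- (1/14)*x^2 + (4/7)*x*z - (1/42)*x*m + (1/7)*z*m) * hm
    + (x^6 + 24*x^5*z + 6*x^5*m - 16*x^4*z^2 - 68*x^4*z*m - 76*x^4*m^2 - 64*x^3*z^3 + 72*x^3*z^2*m + 72*x^3*z*m^2 - 16*x^3*m^3 + 80*x^2*z^4 + 144*x^2*z^3*m - 144*x^2*z^2*m^2 - 48*x^2*z*m^3 + 96*x^2*m^4 - 64*x*z^5) * h0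

theorem bez (x z : ℂ) (h1 : cC x z 0 = 0) (h2 : cE x z 0 = 0) : z ^ 5 = 0 := by
  simp only [cC, cE] at h1 h2
  linear_combination ((1/52)*x^2 - (7/208)*x*z - (3/26)*z^2) * h1 + (- (1/52)*x^2 - (17/208)*x*z + (1/104)*z^2) * h2

theorem ptA_X (t : ℂ) (ht : cC t 1 0 = 0) : gX (t) 1 (- (1/4)*t^2 + 1) = 0 := by
  simp only [cC, gX] at *
  linear_combination ((1/16)*t^7 - (5/8)*t^6 - (3/4)*t^5 + 9*t^4 + 3*t^3 - 28*t^2 + 8*t + 8) * ht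

theorem ptA_Z (t : ℂ) (ht : cC t 1 0 = 0) : gZ (t) 1 (- (1/4)*t^2 + 1) = 0 := by
  simp only [cC, gZ] at *
  linear_combination (0) * ht

theorem ptA_M (t : ℂ) (ht : cC t 1 0 = 0) : gM (t) 1 (- (1/4)*t^2 + 1) = 0 := by
  simp only [cC, gM] at *
  linear_combination (- (3/8)*t^7 + (1/4)*t^6 + 8*t^5 - 5*t^4 - 46*t^3 + 28*t^2 + 64*t - 48) * ht

theorem ptA_minor (t : ℂ) (ht : cC t 1 0 = 0) :
    hXX (t) 1 (- (1/4)*t^2 + 1) * hMM (t) 1 (- (1/4)*t^2 + 1) - hXM (t) 1 (- (1/4)*t^2 + 1) ^ 2 ≠ 0 := by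
  have key : (hXX (t) 1 (- (1/4)*t^2 + 1) * hMM (t) 1 (- (1/4)*t^2 + 1) - hXM (t) 1 (- (1/4)*t^2 + 1) ^ 2)
      * ((107/118716416)*t^2 + (121/29679104)*t + (9/59358208)) = 1 := by
    simp only [cC, hXX, hMM, hXM] at *
    linear_combination (- (535/135675904)*t^15 - (1745/67837952)*t^14 + (695/8479744)*t^13 + (11995/16959488)*t^12 - (1373/5218304)*t^11 - (95439/16959488)*t^10 - (42593/33918976)*t^9 + (7335/1059968)*t^8 - (3229/163072)*t^7 + (183227/4239872)*t^6 + (313589/2119936)*t^5 - (68105/1059968)*t^4 - (81273/529984)*t^3 - (205/132496)*t^2 + (1083/18928)*t + (8587/66248)) * ht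
  intro h
  rw [h, zero_mul] at key
  exact zero_ne_one key

theorem ptB_X (t : ℂ) (ht : cC t 1 0 = 0) : gX (t) 1 ((1/4)*t^2 + t - (1/2)) = 0 := by
  simp only [cC, gX] at *
  linear_combination (- (1/16)*t^7 - (11/8)*t^6 - (63/8)*t^5 - 12*t^4 + (19/2)*t^3 + (41/2)*t^2 + 6*t - 16) * ht

theorem ptB_Z (t : ℂ) (ht : cC t 1 0 = 0) : gZ (t) 1 ((1/4)*t^2 + t - (1/2)) = 0 := by
  simp only [cC, gZ] at *
  linear_combination (- (7/4)*t^5 - (21/2)*t^4 - (21/4)*t^3 + 42*t^2 + (35/2)*t - 42) * ht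

theorem ptB_M (t : ℂ) (ht : cC t 1 0 = 0) : gM (t) 1 ((1/4)*t^2 + t - (1/2)) = 0 := by
  simp only [cC, gM] at *
  linear_combination ((3/8)*t^7 + (19/4)*t^6 + (63/4)*t^5 + 2*t^4 - 43*t^3 - 18*t^2 + 27*t + 12) * ht

theorem ptB_minor (t : ℂ) (ht : cC t 1 0 = 0) :
    hXX (t) 1 ((1/4)*t^2 + t - (1/2)) * hMM (t) 1 ((1/4)*t^2 + t - (1/2)) - hXM (t) 1 ((1/4)*t^2 + t - (1/2)) ^ 2 ≠ 0 := by
  have key : (hXX (t) 1 ((1/4)*t^2 + t - (1/2)) * hMM (t) 1 ((1/4)*t^2 + t - (1/2)) - hXM (t) 1 ((1/4)*t^2 + t - (1/2)) ^ 2)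
      * (- (205/118716416)*t^2 - (9/2119936)*t + (233/14839552)) = 1 := by
    simp only [cC, hXX, hMM, hXM] at *
    linear_combination ((1025/135675904)*t^15 + (12535/67837952)*t^14 + (30365/16959488)*t^13 + (269575/33918976)*t^12 + (153835/16959488)*t^11 - (66037/1211392)*t^10 - (66821/346112)*t^9 - (37691/1211392)*t^8 + (2963881/4239872)*t^7 + (1495909/2119936)*t^6 - (1817421/2119936)*t^5 - (344613/264992)*t^4 + (2175685/4239872)*t^3 + (779115/1059968)*t^2 - (15215/75712)*t + (1041/10192)) * ht
  intro h
  rw [h, zero_mul] at key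
  exact zero_ne_one key

theorem ptE_X (t : ℂ) (ht : cC t 1 0 = 0) : gX (t + 2) 1 (- (1/4)*t^2 - t) = 0 := by
  simp only [cC, gX] at *
  linear_combination ((1/16)*t^7 + (5/8)*t^6 - (5/4)*t^5 - 34*t^4 - 139*t^3 - 220*t^2 - 128*t - 24) * ht

theorem ptE_Z (t : ℂ) (ht : cC t 1 0 = 0) : gZ (t + 2) 1 (- (1/4)*t^2 - t) = 0 := by
  simp only [cC, gZ] at *
  linear_combination (0) * ht

theorem ptE_M (t : ℂ) (ht : cC t 1 0 = 0) : gM (t + 2) 1 (- (1/4)*t^2 - t) = 0 := by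
  simp only [cC, gM] at *
  linear_combination (- (3/8)*t^7 - (29/4)*t^6 - 52*t^5 - 167*t^4 - 216*t^3 - 24*t^2 + 96*t + 32) * ht

theorem ptE_minor (t : ℂ) (ht : cC t 1 0 = 0) :
    hXX (t + 2) 1 (- (1/4)*t^2 - t) * hMM (t + 2) 1 (- (1/4)*t^2 - t) - hXM (t + 2) 1 (- (1/4)*t^2 - t) ^ 2 ≠ 0 := by
  have key : (hXX (t + 2) 1 (- (1/4)*t^2 - t) * hMM (t + 2) 1 (- (1/4)*t^2 - t) - hXM (t + 2) 1 (- (1/4)*t^2 - t) ^ 2)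
      * (- (2351/118716416)*t^2 - (421/7419776)*t + (8425/59358208)) = 1 := by
    simp only [cC, hXX, hMM, hXM] at *
    linear_combination ((11755/135675904)*t^15 + (216675/67837952)*t^14 + (870235/16959488)*t^13 + (7967875/16959488)*t^12 + (181607677/67837952)*t^11 + (81292013/8479744)*t^10 + (94919861/4845568)*t^9 + (43458799/4239872)*t^8 - (238911235/4239872)*t^7 - (92524049/605696)*t^6 - (260987757/2119936)*t^5 + (120717003/1059968)*t^4 + (158611459/529984)*t^3 + (6230325/33124)*t^2 + (2171765/132496)*t - (716269/66248)) * ht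
  intro h
  rw [h, zero_mul] at key
  exact zero_ne_one key

/-- The `x`-coordinates (with `z = 1`) of the nodes over a root `t` of `cC`. -/
noncomputable def px (j : Fin 3) (t : ℂ) : ℂ := ![t, t, t + 2] j

/-- The third coordinates (with `z = 1`) of the nodes over a root `t` of `cC`. -/
noncomputable def pm (j : Fin 3) (t : ℂ) : ℂ :=
  ![-(1/4)*t^2 + 1, (1/4)*t^2 + t - (1/2), -(1/4)*t^2 - t] j

theorem pt_sing (j : Fin 3) (t : ℂ) (ht : cC t 1 0 = 0) :
    gX (px j t) 1 (pm j t) = 0 ∧ gZ (px j t) 1 (pm j t) = 0 ∧ gM (px j t) 1 (pm j t) = 0 := by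
  fin_cases j
  · exact ⟨ptA_X t ht, ptA_Z t ht, ptA_M t ht⟩
  · exact ⟨ptB_X t ht, ptB_Z t ht, ptB_M t ht⟩
  · exact ⟨ptE_X t ht, ptE_Z t ht, ptE_M t ht⟩

theorem pt_minor (j : Fin 3) (t : ℂ) (ht : cC t 1 0 = 0) :
    hXX (px j t) 1 (pm j t) * hMM (px j t) 1 (pm j t) - hXM (px j t) 1 (pm j t) ^ 2 ≠ 0 := by
  fin_cases j
  · exact ptA_minor t ht
  · exact ptB_minor t ht
  · exact ptE_minor t ht

theorem exists_roots : ∃ r : Fin 3 → ℂ, Function.Injective r ∧ (∀ i, cC (r i) 1 0 = 0) ∧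
    ∀ x z : ℂ, cC x z 0 = (x - r 0 * z) * (x - r 1 * z) * (x - r 2 * z) := by
  obtain ⟨t, ht⟩ : ∃ t : ℂ, t ^ 3 + 4 * t ^ 2 - 4 * t - 8 = 0 := by
    have hdeg : (Polynomial.X ^ 3 + Polynomial.C 4 * Polynomial.X ^ 2
        - Polynomial.C 4 * Polynomial.X - Polynomial.C 8 : Polynomial ℂ).degree = 3 := by
      compute_degree!
    obtain ⟨t, ht⟩ := IsAlgClosed.exists_root (Polynomial.X ^ 3 + Polynomial.C 4 * Polynomial.X ^ 2
        - Polynomial.C 4 * Polynomial.X - Polynomial.C 8 : Polynomial ℂ) (by rw [hdeg]; decide)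
    refine ⟨t, ?_⟩
    simpa [Polynomial.IsRoot] using ht
  have hfac : ∀ x z : ℂ, cC x z 0 =
      (x - t * z) * (x - (t ^ 2 / 2 + t - 4) * z) * (x - (-t ^ 2 / 2 - 2 * t) * z) := by
    intro x z
    simp only [cC]
    linear_combination ((t/4+1/2)*x*z^2 - (t^2/4+t/2-1)*z^3)*ht
  have h01 : (t - (t ^ 2 / 2 + t - 4)) ≠ 0 := by
    intro h
    have : (1 : ℂ) = 0 := by linear_combination (- (1/56)*t^2 + (1/28)*t + (5/14)) * h - ((1/112)*t - (3/56)) * ht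
    exact one_ne_zero this
  have h02 : (t - (-t ^ 2 / 2 - 2 * t)) ≠ 0 := by
    intro h
    have : (1 : ℂ) = 0 := by linear_combination ((1/28)*t^2 + (5/28)*t - (3/14)) * h - ((1/56)*t + (1/8)) * ht
    exact one_ne_zero this
  have h12 : ((t ^ 2 / 2 + t - 4) - (-t ^ 2 / 2 - 2 * t)) ≠ 0 := by
    intro h
    have : (1 : ℂ) = 0 := by linear_combination ((3/56)*t^2 + (1/7)*t - (1/14)) * h - ((3/56)*t + (5/56)) * ht
    exact one_ne_zero this
  refine ⟨![t, t ^ 2 / 2 + t - 4, -t ^ 2 / 2 - 2 * t], ?_, ?_, ?_⟩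
  · intro i j hij
    fin_cases i <;> fin_cases j <;> simp at hij ⊢
    · exact h01 (by linear_combination hij)
    · exact h02 (by linear_combination hij)
    · exact h01 (by linear_combination -hij)
    · exact h12 (by linear_combination hij)
    · exact h02 (by linear_combination -hij)
    · exact h12 (by linear_combination -hij)
  · intro i
    rw [hfac]
    fin_cases i <;> simp
  · intro x z
    rw [hfac]
    simp

theorem cE_shift (x z : ℂ) : cE x z 0 = cC (x - 2 * z) z 0 := by
  simp only [cE, cC]; ring

/-- The singular points, up to scaling. -/
theorem sing_cases (x z m : ℂ) (hne : ¬ (x = 0 ∧ z = 0 ∧ m = 0))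
    (hx : gX x z m = 0) (hz : gZ x z m = 0) (hm : gM x z m = 0)
    (r : Fin 3 → ℂ) (hr : ∀ i, cC (r i) 1 0 = 0)
    (hfac : ∀ x z : ℂ, cC x z 0 = (x - r 0 * z) * (x - r 1 * z) * (x - r 2 * z)) :
    z ≠ 0 ∧ ∃ i j, x = px j (r i) * z ∧ m = pm j (r i) * z := by
  have hz0 : z ≠ 0 := by
    intro h0
    have hx0 : x = 0 := by simpa using cert4 x z m hx hz hm h0
    apply hne
    refine ⟨hx0, h0, ?_⟩
    subst hx0; subst h0
    simpa [gM] using hm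
  refine ⟨hz0, ?_⟩
  have hroot : ∀ x, cC x z 0 = 0 → ∃ i, x = r i * z := by
    intro x h
    rw [hfac] at h
    rcases mul_eq_zero.mp h with h | h
    · rcases mul_eq_zero.mp h with h | h
      · exact ⟨0, sub_eq_zero.mp h⟩
      · exact ⟨1, sub_eq_zero.mp h⟩
    · exact ⟨2, sub_eq_zero.mp h⟩
  have c1 : cC x z 0 * cE x z 0 = 0 :=
    (mul_eq_zero.mp (cert1 x z m hx hz hm)).resolve_right (pow_ne_zero _ hz0)
  have c2 : cE x z 0 * cq x z m = 0 :=
    (mul_eq_zero.mp (cert2 x z m hx hz hm)).resolve_right (pow_ne_zero _ hz0)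
  have c3 : cC x z 0 * ch x z m = 0 :=
    (mul_eq_zero.mp (cert3 x z m hx hz hm)).resolve_right (pow_ne_zero _ hz0)
  by_cases hC : cC x z 0 = 0
  · have hE : cE x z 0 ≠ 0 := fun hE => pow_ne_zero _ hz0 (bez x z hC hE)
    have hq := (mul_eq_zero.mp c2).resolve_left hE
    obtain ⟨i, hi⟩ := hroot x hC
    have hri := hr i
    have hprod : (m - (-(1/4)*(r i)^2 + 1) * z) * (m - ((1/4)*(r i)^2 + r i - (1/2)) * z) = 0 := by
      rw [hi] at hq
      simp only [cq] at hq
      simp only [cC] at hri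
      linear_combination (1/8) * hq + (-(r i)/16) * z ^ 2 * hri
    rcases mul_eq_zero.mp hprod with h | h
    · exact ⟨i, 0, hi, sub_eq_zero.mp h⟩
    · exact ⟨i, 1, hi, sub_eq_zero.mp h⟩
  · have hE := (mul_eq_zero.mp c1).resolve_left hC
    have hh := (mul_eq_zero.mp c3).resolve_left hC
    rw [cE_shift] at hE
    obtain ⟨i, hi⟩ := hroot _ hE
    have hx' : x = (r i + 2) * z := by linear_combination hi
    refine ⟨i, 2, hx', ?_⟩
    change m = (-(1/4)*(r i)^2 - r i) * z
    rw [hx'] at hh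
    simp only [ch] at hh
    apply mul_left_cancel₀ hz0
    linear_combination (1/4) * hh

theorem pts_inj (r : Fin 3 → ℂ) (hinj : Function.Injective r) (hr : ∀ i, cC (r i) 1 0 = 0)
    (i i' j j' : Fin 3) (h1 : px j (r i) = px j' (r i')) (h2 : pm j (r i) = pm j' (r i')) :
    i = i' ∧ j = j' := by
  have hsep : ∀ i i', r i ≠ r i' + 2 := by
    intro i i' h
    have h1 := hr i
    have h2 := hr i'
    have : cE (r i) 1 0 = 0 := by
      rw [cE_shift, h]
      simpa using h2
    simpa using bez _ _ h1 this
  have hAB : ∀ i, -(1/4)*(r i)^2 + 1 ≠ (1/4)*(r i)^2 + r i - (1/2) := by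
    intro i h
    have h1 := hr i
    simp only [cC] at h1
    have : (1 : ℂ) = 0 := by linear_combination (- (10/91)*(r i)^2 - (36/91)*(r i) + (18/91)) * h - ((5/91)*(r i) + (8/91)) * h1
    exact one_ne_zero this
  fin_cases j <;> fin_cases j' <;> simp only [px, pm] at h1 h2 <;> simp at h1 <;>
    first
    | exact ⟨hinj h1, rfl⟩
    | exact absurd h1 (hsep _ _)
    | exact absurd h1.symm (hsep _ _)
    | (obtain rfl := hinj h1
       first
       | exact absurd h2 (hAB _)
       | exact absurd h2.symm (hAB _))

theorem S6_identity (A x z m a₁ a₂ a₃ a₄ a₅ : ℂ)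
    (hA : 7 * A ^ 3 + 7 * A + 1 = 0)
    (ha₁ : a₁ = -(12 / 7) * A ^ 2 - (384 / 49) * A - 8 / 7)
    (ha₂ : a₂ = -(32 / 7) * A ^ 2 + (24 / 49) * A - 4)
    (ha₃ : a₃ = -4 * A ^ 2 + (24 / 49) * A - 4)
    (ha₄ : a₄ = -(8 / 7) * A ^ 2 + (8 / 49) * A - 8 / 7)
    (ha₅ : a₅ = 49 * A ^ 2 - 7 * A + 50) (w : ℂ) (hw : w = 7 * A * m - z) :
    x ^ 7 + 7 * z * (x ^ 6 - 8 * z ^ 2 * x ^ 4 + 16 * z ^ 4 * x ^ 2) - 64 * z ^ 7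
      - (z + a₅ * w) * (a₁ * z ^ 3 + a₂ * z ^ 2 * w + a₃ * z * w ^ 2 + a₄ * w ^ 3
        + (z + w) * x ^ 2) ^ 2 = (x + m) * sF x z m := by
  -- `B = 1 / A`
  obtain ⟨B, hB⟩ : ∃ B : ℂ, B = -7 * (A ^ 2 + 1) := ⟨_, rfl⟩
  have hAB : A * B = 1 := by rw [hB]; linear_combination -hA
  have hl : z + a₅ * w = -B ^ 2 * (z + m) := by
    rw [ha₅, hw, hB]; linear_combination (7*A*z + (7*A+49)*m) * hA
  have hQ : B * (a₁ * z ^ 3 + a₂ * z ^ 2 * w + a₃ * z * w ^ 2 + a₄ * w ^ 3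
        + (z + w) * x ^ 2) = 7*x^2*m - 8*z^3 + 4*z^2*m + 4*z*m^2 - 8*m^3 := by
    rw [ha₁, ha₂, ha₃, ha₄, hw, hB]
    linear_combination ((8) * (z^3) + (- 4) * (z^2*m) + (28*A^3 + 28*A - 4) * (z*m^2) + (392*A^4 - 56*A^3 + 392*A^2 - 56*A + 8) * (m^3) + (- 7) * (x^2*m)) * hA
  rw [hl]
  have : -B ^ 2 * (z + m) * (a₁ * z ^ 3 + a₂ * z ^ 2 * w + a₃ * z * w ^ 2 + a₄ * w ^ 3
        + (z + w) * x ^ 2) ^ 2 = -(z + m) * (7*x^2*m - 8*z^3 + 4*z^2*m + 4*z*m^2 - 8*m^3) ^ 2 := by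
    rw [← hQ]; ring
  rw [this]
  simp only [sF]
  ring

theorem rank_two (H : Matrix (Fin 3) (Fin 3) ℂ) (v : Fin 3 → ℂ) (hv : v ≠ 0)
    (h0 : H.mulVec v = 0) (hmin : H 0 0 * H 2 2 - H 0 2 * H 2 0 ≠ 0) : H.rank = 2 := by
  apply le_antisymm
  · have h1 := LinearMap.finrank_range_add_finrank_ker H.mulVecLin
    have h2 : 0 < Module.finrank ℂ (LinearMap.ker H.mulVecLin) := by
      rw [Module.finrank_pos_iff]
      refine ⟨⟨⟨v, by simpa using h0⟩, 0, ?_⟩⟩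
      intro h
      exact hv (congrArg Subtype.val h)
    have h3 : Module.finrank ℂ (Fin 3 → ℂ) = 3 := by simp
    rw [h3] at h1
    unfold Matrix.rank
    omega
  · have h1 := Matrix.rank_submatrix_le H ![0, 2] ![0, 2]
    have h2 : (H.submatrix ![0, 2] ![0, 2]).rank = 2 := by
      rw [Matrix.rank_of_isUnit]
      · simp
      · rw [Matrix.isUnit_iff_isUnit_det, isUnit_iff_ne_zero, Matrix.det_fin_two]
        simpa using hmin
    omega
/-- For α with 7α³ + 7α + 1 = 0 and the parameters of the theorem,
if S₆ ∈ ℂ[x,z,w] is the sextic factor in the splitting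
S_α(x, 0, z, w) = (z − x/(1+α²) + w) · S₆(x,z,w), then the plane sextic curve
{S₆ = 0} ⊂ ℙ²(ℂ) has exactly 9 singular points, all of which are nodes.
(Variables of ℂ[x,z,w]: `X 0 = x, X 1 = z, X 2 = w`.) -/
theorem plane_sextic_9_nodes (α : ℂ) (hα : 7 * α ^ 3 + 7 * α + 1 = 0)
    (a₁ a₂ a₃ a₄ a₅ : ℂ)
    (ha₁ : a₁ = -(12 / 7) * α ^ 2 - (384 / 49) * α - 8 / 7)
    (ha₂ : a₂ = -(32 / 7) * α ^ 2 + (24 / 49) * α - 4)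
    (ha₃ : a₃ = -4 * α ^ 2 + (24 / 49) * α - 4)
    (ha₄ : a₄ = -(8 / 7) * α ^ 2 + (8 / 49) * α - 8 / 7)
    (ha₅ : a₅ = 49 * α ^ 2 - 7 * α + 50)
    (S : MvPolynomial (Fin 4) ℂ) (hS : S = Psept - Usept a₁ a₂ a₃ a₄ a₅)
    (Sy : MvPolynomial (Fin 3) ℂ)
    (hSy : Sy = aeval (![X 0, 0, X 1, X 2] : Fin 4 → MvPolynomial (Fin 3) ℂ) S)
    (S₆ : MvPolynomial (Fin 3) ℂ)
    (hsplit : Sy = (X 1 - C (1 / (1 + α ^ 2)) * X 0 + X 2) * S₆) :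
    {q : Projectivization ℂ (Fin 3 → ℂ) | IsSingularPoint S₆ q}.ncard = 9 ∧
      ∀ q : Projectivization ℂ (Fin 3 → ℂ),
        IsSingularPoint S₆ q → IsNode S₆ q := by
  have hk0 : (1 + α ^ 2) ≠ 0 := by
    intro h
    have : (1 : ℂ) = 0 := by linear_combination hα - 7 * α * h
    exact one_ne_zero this
  have hα0 : α ≠ 0 := by
    rintro rfl
    simp at hα
  obtain ⟨k, hk⟩ : ∃ k : ℂ, k = -(1 + α ^ 2) := ⟨_, rfl⟩
  have hkne : k ≠ 0 := by rw [hk]; exact neg_ne_zero.mpr hk0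
  have hkα : 7 * α * k = 1 := by rw [hk]; linear_combination -hα
  have hinv : 1 / (1 + α ^ 2) = -7 * α := by
    field_simp
    linear_combination hα
  obtain ⟨M, hM⟩ : ∃ M : MvPolynomial (Fin 3) ℂ, M = C k * (X 1 + X 2) := ⟨_, rfl⟩
  have evM : ∀ v, eval v M = k * (v 1 + v 2) := by intro v; rw [hM]; simp
  have hL0 : (X 1 - C (1 / (1 + α ^ 2)) * X 0 + X 2 : MvPolynomial (Fin 3) ℂ) ≠ 0 := by
    intro h
    have := congrArg (eval ![0, 1, 0]) h
    simp at this
  -- the sextic in good coordinates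
  have hS6 : S₆ = C k * sF (X 0) (X 1) M := by
    apply mul_left_cancel₀ hL0
    rw [← hsplit, hSy, hS]
    apply MvPolynomial.funext
    intro v
    have key := S6_identity α (v 0) (v 1) (k * (v 1 + v 2)) a₁ a₂ a₃ a₄ a₅ hα
      ha₁ ha₂ ha₃ ha₄ ha₅ (v 2) (by linear_combination -(v 1 + v 2) * hkα)
    rw [hinv]
    simp only [map_mul, map_sub, map_add, eval_X, eval_C, eval_sF, evM, Psept, Usept, map_pow,
      aeval_X, aeval_C, algebraMap_eq, map_ofNat, Matrix.cons_val, map_zero]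
    linear_combination key
      - (v 0) * sF (v 0) (v 1) (k * (v 1 + v 2)) * hkα
  have dM0 : pderiv 0 M = 0 := by rw [hM]; simp [pderiv_X]
  have dM1 : pderiv 1 M = C k := by rw [hM]; simp [pderiv_X]
  have dM2 : pderiv 2 M = C k := by rw [hM]; simp [pderiv_X]
  have p0 : pderiv 0 S₆ = C k * gX (X 0) (X 1) M := by
    rw [hS6, pderiv_C_mul, D_sF, dM0]; simp [pderiv_X]
  have p1 : pderiv 1 S₆ = C k * (gZ (X 0) (X 1) M + C k * gM (X 0) (X 1) M) := by
    rw [hS6, pderiv_C_mul, D_sF, dM1]; simp [-mul_eq_mul_left_iff, -mul_eq_mul_right_iff, pderiv_X]; ring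
  have p2 : pderiv 2 S₆ = C k * (C k * gM (X 0) (X 1) M) := by
    rw [hS6, pderiv_C_mul, D_sF, dM2]; simp [-mul_eq_mul_left_iff, -mul_eq_mul_right_iff, pderiv_X]; ring
  have hsing : ∀ v, VanishingJacobianAt S₆ v ↔ (gX (v 0) (v 1) (k * (v 1 + v 2)) = 0 ∧
      gZ (v 0) (v 1) (k * (v 1 + v 2)) = 0 ∧ gM (v 0) (v 1) (k * (v 1 + v 2)) = 0) := by
    intro v
    unfold VanishingJacobianAt
    rw [Fin.forall_fin_succ, Fin.forall_fin_succ, Fin.forall_fin_succ]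
    simp only [Fin.succ_zero_eq_one, Fin.succ_one_eq_two, p0, p1, p2, IsEmpty.forall_iff, and_true,
      map_mul, map_add, eval_C, eval_gX, eval_gZ, eval_gM, eval_X, evM, mul_eq_zero, hkne, false_or]
    constructor
    · rintro ⟨h0, h1, h2⟩
      rw [h2, mul_zero, add_zero] at h1
      exact ⟨h0, h1, h2⟩
    · rintro ⟨h0, h1, h2⟩
      rw [h2, mul_zero, add_zero]
      exact ⟨h0, h1, rfl⟩
  have hnode : ∀ v : Fin 3 → ℂ, v ≠ 0 → VanishingJacobianAt S₆ v →
      hXX (v 0) (v 1) (k * (v 1 + v 2)) * hMM (v 0) (v 1) (k * (v 1 + v 2))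
        - hXM (v 0) (v 1) (k * (v 1 + v 2)) ^ 2 ≠ 0 → (hessianAt S₆ v).rank = 2 := by
    intro v hv hs hmin
    obtain ⟨s0, s1, s2⟩ := (hsing v).mp hs
    have eX := euler_gX (v 0) (v 1) (k * (v 1 + v 2))
    have eZ := euler_gZ (v 0) (v 1) (k * (v 1 + v 2))
    have eM := euler_gM (v 0) (v 1) (k * (v 1 + v 2))
    rw [s0] at eX
    rw [s1] at eZ
    rw [s2] at eM
    have H00 : hessianAt S₆ v 0 0 = k * hXX (v 0) (v 1) (k * (v 1 + v 2)) := by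
      simp [hessianAt, p0, D_gX, pderiv_X, dM0, eval_hXX, evM]
    have H10 : hessianAt S₆ v 1 0 = k * (hXZ (v 0) (v 1) (k * (v 1 + v 2))
        + k * hXM (v 0) (v 1) (k * (v 1 + v 2))) := by
      simp [-mul_eq_mul_left_iff, -mul_eq_mul_right_iff, hessianAt, p0, D_gX, pderiv_X, dM1, eval_hXZ, eval_hXM, evM]; ring
    have H20 : hessianAt S₆ v 2 0 = k * (k * hXM (v 0) (v 1) (k * (v 1 + v 2))) := by
      simp [-mul_eq_mul_left_iff, -mul_eq_mul_right_iff, hessianAt, p0, D_gX, pderiv_X, dM2, eval_hXM, evM]; ring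
    have H01 : hessianAt S₆ v 0 1 = k * (hXZ (v 0) (v 1) (k * (v 1 + v 2))
        + k * hXM (v 0) (v 1) (k * (v 1 + v 2))) := by
      simp [hessianAt, p1, D_gZ, D_gM, pderiv_X, dM0, eval_hXZ, eval_hXM, evM]
    have H11 : hessianAt S₆ v 1 1 = k * (hZZ (v 0) (v 1) (k * (v 1 + v 2))
        + 2 * k * hZM (v 0) (v 1) (k * (v 1 + v 2))
        + k ^ 2 * hMM (v 0) (v 1) (k * (v 1 + v 2))) := by
      simp [-mul_eq_mul_left_iff, -mul_eq_mul_right_iff, hessianAt, p1, D_gZ, D_gM, pderiv_X, dM1, eval_hZZ, eval_hZM, eval_hMM, evM]; ring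
    have H21 : hessianAt S₆ v 2 1 = k * (k * hZM (v 0) (v 1) (k * (v 1 + v 2))
        + k ^ 2 * hMM (v 0) (v 1) (k * (v 1 + v 2))) := by
      simp [-mul_eq_mul_left_iff, -mul_eq_mul_right_iff, hessianAt, p1, D_gZ, D_gM, pderiv_X, dM2, eval_hZM, eval_hMM, evM]; ring
    have H02 : hessianAt S₆ v 0 2 = k * (k * hXM (v 0) (v 1) (k * (v 1 + v 2))) := by
      simp [hessianAt, p2, D_gM, pderiv_X, dM0, eval_hXM, evM]
    have H12 : hessianAt S₆ v 1 2 = k * (k * hZM (v 0) (v 1) (k * (v 1 + v 2))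
        + k ^ 2 * hMM (v 0) (v 1) (k * (v 1 + v 2))) := by
      simp [-mul_eq_mul_left_iff, -mul_eq_mul_right_iff, hessianAt, p2, D_gM, pderiv_X, dM1, eval_hZM, eval_hMM, evM]; ring
    have H22 : hessianAt S₆ v 2 2 = k * (k ^ 2 * hMM (v 0) (v 1) (k * (v 1 + v 2))) := by
      simp [-mul_eq_mul_left_iff, -mul_eq_mul_right_iff, hessianAt, p2, D_gM, pderiv_X, dM2, eval_hMM, evM]; ring
    apply rank_two _ v hv
    · funext i
      rw [Matrix.mulVec, dotProduct, Fin.sum_univ_three]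
      fin_cases i
      · simp only [Fin.zero_eta, H00, H01, H02, Pi.zero_apply]
        linear_combination k * eX
      · simp only [Fin.mk_one, H10, H11, H12, Pi.zero_apply]
        linear_combination k * eZ + k ^ 2 * eM
      · simp only [Fin.reduceFinMk, H20, H21, H22, Pi.zero_apply]
        linear_combination k ^ 2 * eM
    · rw [H00, H22, H02, H20]
      have : k * hXX (v 0) (v 1) (k * (v 1 + v 2)) * (k * (k ^ 2 * hMM (v 0) (v 1) (k * (v 1 + v 2))))
          - k * (k * hXM (v 0) (v 1) (k * (v 1 + v 2))) * (k * (k * hXM (v 0) (v 1) (k * (v 1 + v 2))))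
          = k ^ 4 * (hXX (v 0) (v 1) (k * (v 1 + v 2)) * hMM (v 0) (v 1) (k * (v 1 + v 2))
        - hXM (v 0) (v 1) (k * (v 1 + v 2)) ^ 2) := by ring
      rw [this]
      exact mul_ne_zero (pow_ne_zero _ hkne) hmin
  -- the nine points
  obtain ⟨r, hrinj, hr, hfac⟩ := exists_roots
  obtain ⟨V, hV⟩ : ∃ V : Fin 3 × Fin 3 → (Fin 3 → ℂ),
      ∀ p, V p = ![px p.2 (r p.1), 1, 7 * α * pm p.2 (r p.1) - 1] := ⟨_, fun _ => rfl⟩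
  have V0 : ∀ p, V p 0 = px p.2 (r p.1) := by intro p; rw [hV]; rfl
  have V1 : ∀ p, V p 1 = 1 := by intro p; rw [hV]; rfl
  have V2 : ∀ p, V p 2 = 7 * α * pm p.2 (r p.1) - 1 := by intro p; rw [hV]; rfl
  have Vm : ∀ p, k * (V p 1 + V p 2) = pm p.2 (r p.1) := by
    intro p
    rw [V1, V2]
    linear_combination pm p.2 (r p.1) * hkα
  have Vne : ∀ p, V p ≠ 0 := by
    intro p h
    have := congrFun h 1
    rw [V1] at this
    exact one_ne_zero this
  have Vsing : ∀ p, VanishingJacobianAt S₆ (V p) := by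
    intro p
    rw [hsing, Vm, V0, V1]
    exact pt_sing _ _ (hr _)
  have hchar : ∀ q : Projectivization ℂ (Fin 3 → ℂ), IsSingularPoint S₆ q →
      ∃ p, Projectivization.mk ℂ (V p) (Vne p) = q := by
    rintro q ⟨v, hv, rfl, hs⟩
    obtain ⟨s0, s1, s2⟩ := (hsing v).mp hs
    have hne : ¬ (v 0 = 0 ∧ v 1 = 0 ∧ k * (v 1 + v 2) = 0) := by
      rintro ⟨h0, h1, h2⟩
      apply hv
      have h2' : v 2 = 0 := by
        have := (mul_eq_zero.mp h2).resolve_left hkne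
        rwa [h1, zero_add] at this
      funext i
      fin_cases i
      · exact h0
      · exact h1
      · exact h2'
    obtain ⟨hz, i, j, hx, hm⟩ := sing_cases _ _ _ hne s0 s1 s2 r hr hfac
    refine ⟨(i, j), ?_⟩
    symm
    rw [Projectivization.mk_eq_mk_iff']
    refine ⟨v 1, ?_⟩
    funext l
    rw [Pi.smul_apply, smul_eq_mul]
    fin_cases l
    · simp only [Fin.zero_eta, V0]
      linear_combination -hx
    · simp only [Fin.mk_one, V1, mul_one]
    · simp only [Fin.reduceFinMk, V2]
      linear_combination -7 * α * hm + (v 1 + v 2) * hkα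
  constructor
  · have hset : {q : Projectivization ℂ (Fin 3 → ℂ) | IsSingularPoint S₆ q}
        = Set.range (fun p => Projectivization.mk ℂ (V p) (Vne p)) := by
      ext q
      constructor
      · intro h
        exact hchar q h
      · rintro ⟨p, rfl⟩
        exact ⟨V p, Vne p, rfl, Vsing p⟩
    rw [hset, Set.ncard_range_of_injective]
    · simp
    · intro p p' h
      obtain ⟨a, ha⟩ := (Projectivization.mk_eq_mk_iff' ℂ _ _ _ _).mp h
      have h1 := congrFun ha 1
      rw [Pi.smul_apply, V1, V1, smul_eq_mul, mul_one] at h1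
      rw [h1, one_smul] at ha
      have e0 : px p.2 (r p.1) = px p'.2 (r p'.1) := by rw [← V0, ← V0, ha]
      have e2 : pm p.2 (r p.1) = pm p'.2 (r p'.1) := by rw [← Vm, ← Vm, ha]
      obtain ⟨h1, h2⟩ := pts_inj r hrinj hr _ _ _ _ e0 e2
      exact Prod.ext h1 h2
  · intro q hq
    obtain ⟨p, rfl⟩ := hchar q hq
    refine ⟨V p, Vne p, rfl, Vsing p, hnode _ (Vne p) (Vsing p) ?_⟩
    rw [Vm, V0, V1]
    exact pt_minor _ _ (hr _)
end
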